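/- (Exact recovery, achievability.) In the Gaussian contextual graph matching model with parameters (n,d,ρ,η), if d = ω(log n) and there exists ε > 0 such that for all sufficiently large n, ρ²n/(1−ρ²) + η²d/(1−η²) ≥ 4(1+ε) log n, then there exists an estimator π̂ : (A,B,X,Y) → S_n (the maximum-a-posteriori estimator) such that P(π̂ = π*) = 1 − o(1) as n → ∞. -/

import Mathlib

open MeasureTheory ProbabilityTheory Real Filter Finset Topology

noncomputable section

namespace CGM

/-- array of (potential) edge weights of a graph on `n` vertices -/
abbrev GW (n : ℕ) := Fin n → Fin n → ℝ

/-- array of feature values: `n` users, `d` features each -/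
abbrev FW (n d : ℕ) := Fin n → Fin d → ℝ

/-- latent sample space: (graph weights, graph noise, features, feature noise) -/
abbrev Samp (n d : ℕ) := (GW n × GW n) × (FW n d × FW n d)

/-- i.i.d. standard Gaussian array (graph part) -/
def stdGaussG (n : ℕ) : Measure (GW n) :=
  Measure.pi fun _ => Measure.pi fun _ => gaussianReal 0 1

/-- i.i.d. standard Gaussian array (feature part) -/
def stdGaussF (n d : ℕ) : Measure (FW n d) :=
  Measure.pi fun _ => Measure.pi fun _ => gaussianReal 0 1

/-- law of the latent randomness of the model -/
def μ (n d : ℕ) : Measure (Samp n d) :=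
  ((stdGaussG n).prod (stdGaussG n)).prod ((stdGaussF n d).prod (stdGaussF n d))

/-- symmetrization of an array, so that only the upper-triangular part matters -/
def sym {n : ℕ} (f : GW n) : GW n := fun i j => if i ≤ j then f i j else f j i

variable {n d : ℕ}

/-- the weighted adjacency matrix `A` -/
def Amat (ω : Samp n d) : GW n := sym ω.1.1

/-- the weighted adjacency matrix `B` (before relabeling by `π*`, i.e. conditionally
on `π* = id`): each pair `(A i j, B i j)`, `i < j`, is bivariate centered Gaussian
with unit variances and correlation `ρ`. -/
def Bmat (ρ : ℝ) (ω : Samp n d) : GW n :=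
  fun i j => ρ * Amat ω i j + Real.sqrt (1 - ρ ^ 2) * sym ω.1.2 i j

/-- the feature matrix `X` -/
def Xmat (ω : Samp n d) : FW n d := ω.2.1

/-- the feature matrix `Y` (conditionally on `π* = id`): each pair `(X i j, Y i j)` is
bivariate centered Gaussian with unit variances and correlation `η`. -/
def Ymat (η : ℝ) (ω : Samp n d) : FW n d :=
  fun i j => η * ω.2.1 i j + Real.sqrt (1 - η ^ 2) * ω.2.2 i j

/-- the ordered pairs `i < j` whose unordered pair `{i,j}` is moved by `φ`;
its cardinality is `|D^E_φ|`. -/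
def movedEdges (φ : Equiv.Perm (Fin n)) : Finset (Fin n × Fin n) :=
  Finset.univ.filter fun p =>
    p.1 < p.2 ∧ ¬((φ p.1 = p.1 ∧ φ p.2 = p.2) ∨ (φ p.1 = p.2 ∧ φ p.2 = p.1))

/-- `V*_G(φ) = Σ_{{i,j} ∈ D^E_φ} B_{ij} A_{ij}` -/
def VGstar (ρ : ℝ) (φ : Equiv.Perm (Fin n)) (ω : Samp n d) : ℝ :=
  ∑ p ∈ movedEdges φ, Bmat ρ ω p.1 p.2 * Amat ω p.1 p.2

/-- `V_G(φ) = Σ_{{i,j} ∈ D^E_φ} B_{φ(i,j)} A_{ij}` -/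
def VG (ρ : ℝ) (φ : Equiv.Perm (Fin n)) (ω : Samp n d) : ℝ :=
  ∑ p ∈ movedEdges φ, Bmat ρ ω (φ p.1) (φ p.2) * Amat ω p.1 p.2

/-- `V*_F(φ) = Σ_{i ∈ D_φ, j ≤ d} Y_{ij} X_{ij}` -/
def VFstar (η : ℝ) (φ : Equiv.Perm (Fin n)) (ω : Samp n d) : ℝ :=
  ∑ i ∈ φ.support, ∑ j, Ymat η ω i j * Xmat ω i j

/-- `V_F(φ) = Σ_{i ∈ D_φ, j ≤ d} Y_{φ(i),j} X_{ij}` -/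
def VF (η : ℝ) (φ : Equiv.Perm (Fin n)) (ω : Samp n d) : ℝ :=
  ∑ i ∈ φ.support, ∑ j, Ymat η ω (φ i) j * Xmat ω i j

/-- the Hamiltonian `V(φ)` -/
def V (ρ η : ℝ) (φ : Equiv.Perm (Fin n)) (ω : Samp n d) : ℝ :=
  ρ / (1 - ρ ^ 2) * (VGstar ρ φ ω - VG ρ φ ω)
    + η / (1 - η ^ 2) * (VFstar η φ ω - VF η φ ω)

/-- the partition function `Z = Σ_φ exp(−V(φ))` -/
def Zpart (ρ η : ℝ) (ω : Samp n d) : ℝ :=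
  ∑ φ : Equiv.Perm (Fin n), Real.exp (-(V ρ η φ ω))

end CGM

namespace CGM

instance permMeasurableSpace (n : ℕ) : MeasurableSpace (Equiv.Perm (Fin n)) := ⊤

/-- the uniform distribution on permutations of `[n]` -/
def unifPerm (n : ℕ) : Measure (Equiv.Perm (Fin n)) :=
  (PMF.uniformOfFintype (Equiv.Perm (Fin n))).toMeasure

/-- sample space of the (unconditioned) model: latent randomness together with the
uniformly random hidden permutation `π*` -/
abbrev SampU (n d : ℕ) := Samp n d × Equiv.Perm (Fin n)

/-- law of the (unconditioned) model -/
def μU (n d : ℕ) : Measure (SampU n d) := (μ n d).prod (unifPerm n)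

/-- the hidden permutation `π*` -/
def πstar {n d : ℕ} (ω : SampU n d) : Equiv.Perm (Fin n) := ω.2

/-- type of the observed data `(A, B, X, Y)` -/
abbrev Obs (n d : ℕ) := GW n × GW n × FW n d × FW n d

/-- the observed data: `A`, `B` (with rows/columns relabeled by `π*`), `X`,
`Y` (with rows relabeled by `π*`), so that `B_{π*(i),π*(j)}` is `ρ`-correlated with
`A_{ij}` and `Y_{π*(i),j}` is `η`-correlated with `X_{ij}`. -/
def obs {n d : ℕ} (ρ η : ℝ) (ω : SampU n d) : Obs n d :=
  (Amat ω.1,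
   fun i j => Bmat ρ ω.1 (ω.2⁻¹ i) (ω.2⁻¹ j),
   Xmat ω.1,
   fun i j => Ymat η ω.1 (ω.2⁻¹ i) j)

/-- the overlap `ov(φ,φ') = |{i : φ(i) = φ'(i)}| / n` between two permutations -/
def ov {n : ℕ} (φ φ' : Equiv.Perm (Fin n)) : ℝ :=
  ((Finset.univ.filter fun i => φ i = φ' i).card : ℝ) / n

end CGM

namespace CGM

section GaussianVectors

variable {I : Type*} [Fintype I]

/-- The law of a vector of independent standard Gaussian variables indexed by `I`. -/
def stdGauss (I : Type*) [Fintype I] : Measure (I → ℝ) :=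
  Measure.pi fun _ => gaussianReal 0 1

instance : IsProbabilityMeasure (stdGauss I) := by
  unfold stdGauss; infer_instance

lemma lintegral_prod_stdGauss (f : I → ℝ → ENNReal) (hf : ∀ i, Measurable (f i)) :
    ∫⁻ g, ∏ i, f i (g i) ∂(stdGauss I) = ∏ i, ∫⁻ x, f i x ∂(gaussianReal 0 1) := by
  unfold stdGauss
  have h := lintegral_prod_eq_prod_lintegral_of_indepFun
    (μ := Measure.pi fun _ : I => gaussianReal 0 1) Finset.univ (fun i g => f i (g i))
    (iIndepFun_pi fun i => (hf i).aemeasurable) (fun i => (hf i).comp (measurable_pi_apply i))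
  rw [h]
  refine Finset.prod_congr rfl fun i _ => ?_
  exact (measurePreserving_eval (fun _ : I => gaussianReal 0 1) i).lintegral_comp (hf i)

lemma ofReal_exp_sum (f : I → ℝ) :
    ENNReal.ofReal (exp (∑ i, f i)) = ∏ i, ENNReal.ofReal (exp (f i)) := by
  rw [Real.exp_sum, ENNReal.ofReal_prod_of_nonneg fun i _ => (exp_pos _).le]

lemma lintegral_exp_mul_gaussianReal (c : ℝ) :
    ∫⁻ x, ENNReal.ofReal (exp (c * x)) ∂(gaussianReal 0 1) = ENNReal.ofReal (exp (c ^ 2 / 2)) := by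
  rw [← ofReal_integral_eq_lintegral_ofReal (integrable_exp_mul_gaussianReal c)
    (ae_of_all _ fun x => (exp_pos _).le)]
  congr 1
  have := congrFun (mgf_fun_id_gaussianReal (μ := 0) (v := 1)) c
  simpa [mgf] using this

/-- Laplace transform of a linear form in independent standard Gaussian variables. -/
lemma lintegral_exp_linear (c : I → ℝ) :
    ∫⁻ g, ENNReal.ofReal (exp (∑ i, c i * g i)) ∂(stdGauss I)
      = ENNReal.ofReal (exp (∑ i, c i ^ 2 / 2)) := by
  simp_rw [ofReal_exp_sum, ← lintegral_exp_mul_gaussianReal]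
  exact lintegral_prod_stdGauss (fun i x => ENNReal.ofReal (exp (c i * x)))
    fun i => by fun_prop

lemma inv_sqrt_one_add_le {b : ℝ} (hb : -(1 / 4) ≤ b) :
    (√(1 + 2 * b))⁻¹ ≤ exp (-b + 2 * b ^ 2) := by
  have h1 : 0 < 1 + 2 * b := by linarith
  have hlog : 2 * b - 4 * b ^ 2 ≤ Real.log (1 + 2 * b) := by
    rcases le_total 0 b with hb0 | hb0
    · have h2 := Real.one_sub_inv_le_log_of_pos h1
      have h3 : 1 - (1 + 2 * b)⁻¹ - (2 * b - 4 * b ^ 2) = 8 * b ^ 3 / (1 + 2 * b) := by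
        field_simp; ring
      have h4 : 0 ≤ 8 * b ^ 3 / (1 + 2 * b) := by positivity
      linarith
    · rw [Real.le_log_iff_exp_le h1]
      have h2 := Real.quadratic_le_exp_of_nonneg (x := -(2 * b - 4 * b ^ 2)) (by nlinarith)
      have h3 : 1 ≤ (1 + 2 * b) * exp (-(2 * b - 4 * b ^ 2)) := by
        refine le_trans ?_ (mul_le_mul_of_nonneg_left h2 h1.le)
        obtain ⟨z, rfl⟩ : ∃ z, b = -z := ⟨-b, by ring⟩
        have hz : 0 ≤ z := by linarith
        have hz4 : z ≤ 1 / 4 := by linarith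
        have : (1 + 2 * -z) * (1 + -(2 * -z - 4 * (-z) ^ 2) + (-(2 * -z - 4 * (-z) ^ 2)) ^ 2 / 2) - 1
            = 2 * z ^ 2 * (1 - 2 * z - 4 * z ^ 2 - 8 * z ^ 3) := by ring
        have h5 : 0 ≤ 1 - 2 * z - 4 * z ^ 2 - 8 * z ^ 3 := by
          have : z ^ 2 ≤ 1 / 16 := by nlinarith
          have : z ^ 3 ≤ 1 / 64 := by nlinarith
          linarith
        nlinarith [mul_nonneg (mul_nonneg zero_le_two (sq_nonneg z)) h5]
      have h4 := mul_le_mul_of_nonneg_right h3 (exp_pos (2 * b - 4 * b ^ 2)).le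
      rwa [one_mul, mul_assoc, ← Real.exp_add, neg_add_cancel, Real.exp_zero, mul_one] at h4
  have h4 : (√(1 + 2 * b))⁻¹ = exp (-(Real.log (1 + 2 * b) / 2)) := by
    rw [Real.exp_neg, ← Real.log_sqrt h1.le, Real.exp_log (Real.sqrt_pos.2 h1)]
  rw [h4]
  gcongr
  linarith

lemma lintegral_exp_neg_sq_gaussianReal_le {b : ℝ} (hb : -(1 / 4) ≤ b) :
    ∫⁻ x, ENNReal.ofReal (exp (-b * x ^ 2)) ∂(gaussianReal 0 1)
      ≤ ENNReal.ofReal (exp (-b + 2 * b ^ 2)) := by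
  have h1 : 0 < 1 + 2 * b := by linarith
  have h2 : 0 < 1 / 2 + b := by linarith
  have key : ∫⁻ x, ENNReal.ofReal (exp (-b * x ^ 2)) ∂(gaussianReal 0 1)
      = ENNReal.ofReal ((√(1 + 2 * b))⁻¹) := by
    rw [gaussianReal_of_var_ne_zero 0 one_ne_zero,
      lintegral_withDensity_eq_lintegral_mul _ (measurable_gaussianPDF 0 1) (by fun_prop)]
    have : ∀ x : ℝ, (gaussianPDF 0 1 * fun x => ENNReal.ofReal (exp (-b * x ^ 2))) x
        = ENNReal.ofReal ((√(2 * π))⁻¹ * exp (-(1 / 2 + b) * x ^ 2)) := by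
      intro x
      simp only [Pi.mul_apply, gaussianPDF, gaussianPDFReal]
      rw [← ENNReal.ofReal_mul (by positivity), mul_assoc, ← Real.exp_add]
      congr 3
      · simp
      · simp; ring
    simp_rw [this]
    rw [← ofReal_integral_eq_lintegral_ofReal
      ((integrable_exp_neg_mul_sq h2).const_mul _) (ae_of_all _ fun x => by positivity),
      integral_const_mul, integral_gaussian]
    congr 1
    rw [← Real.sqrt_inv, ← Real.sqrt_inv, ← Real.sqrt_mul (by positivity)]
    congr 1
    field_simp
  rw [key]
  exact ENNReal.ofReal_le_ofReal (inv_sqrt_one_add_le hb)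

/-- Bound on the Laplace transform of a diagonal quadratic form in independent standard
Gaussian variables. -/
lemma lintegral_exp_neg_sum_sq_le (b : I → ℝ) (hb : ∀ i, -(1 / 4) ≤ b i) :
    ∫⁻ g, ENNReal.ofReal (exp (∑ i, -b i * g i ^ 2)) ∂(stdGauss I)
      ≤ ENNReal.ofReal (exp (∑ i, (-b i + 2 * b i ^ 2))) := by
  simp_rw [ofReal_exp_sum]
  rw [lintegral_prod_stdGauss (fun i x => ENNReal.ofReal (exp (-b i * x ^ 2)))
    fun i => by fun_prop]
  exact Finset.prod_le_prod' fun i _ => lintegral_exp_neg_sq_gaussianReal_le (hb i)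

/-- Rotating two independent standard Gaussian vectors by `π / 4` preserves their law. -/
lemma measurePreserving_rotation_stdGauss :
    MeasurePreserving
      (fun p : (I → ℝ) × (I → ℝ) =>
        ((fun i => √2 / 2 * (p.1 i + p.2 i), fun i => √2 / 2 * (p.2 i - p.1 i)) :
          (I → ℝ) × (I → ℝ)))
      ((stdGauss I).prod (stdGauss I)) ((stdGauss I).prod (stdGauss I)) := by
  have h1 : MeasurePreserving (ContinuousLinearMap.rotation (π / 4) : ℝ × ℝ →L[ℝ] ℝ × ℝ)
      ((gaussianReal 0 1).prod (gaussianReal 0 1)) ((gaussianReal 0 1).prod (gaussianReal 0 1)) :=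
    ⟨by fun_prop, IsGaussian.map_rotation_eq_self (by simp) _⟩
  have h2 := measurePreserving_pi (fun _ : I => (gaussianReal 0 1).prod (gaussianReal 0 1))
    (fun _ : I => (gaussianReal 0 1).prod (gaussianReal 0 1)) (fun _ => h1)
  have h3 := measurePreserving_arrowProdEquivProdArrow ℝ ℝ I (fun _ => gaussianReal 0 1)
    (fun _ => gaussianReal 0 1)
  have h4 := h3.comp (h2.comp h3.symm)
  unfold stdGauss
  convert h4 using 1
  ext p i
  · simp [MeasurableEquiv.arrowProdEquivProdArrow, Equiv.arrowProdEquivProdArrow,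
      ContinuousLinearMap.rotation_apply]
    ring
  · simp [MeasurableEquiv.arrowProdEquivProdArrow, Equiv.arrowProdEquivProdArrow,
      ContinuousLinearMap.rotation_apply]
    ring

end GaussianVectors

end CGM

namespace CGM

section Chaos

variable {I : Type*} [Fintype I]

lemma integrable_mul_and_integral_mul_stdGauss {i j : I} (hij : i ≠ j) :
    Integrable (fun g : I → ℝ => g i * g j) (stdGauss I) ∧
      ∫ g, g i * g j ∂(stdGauss I) = 0 := by
  have hind : iIndepFun (fun (k : I) (g : I → ℝ) => g k) (stdGauss I) :=
    iIndepFun_pi (X := fun (_ : I) (x : ℝ) => x) fun _ => aemeasurable_id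
  have hmp : ∀ k : I, MeasurePreserving (fun g : I → ℝ => g k) (stdGauss I) (gaussianReal 0 1) :=
    fun k => measurePreserving_eval (fun _ : I => gaussianReal 0 1) k
  have h_exp : ∀ k : I, Integrable (fun g : I → ℝ => g k) (stdGauss I) := fun k => by
    have h : Integrable (fun x : ℝ => x) (gaussianReal 0 1) :=
      (memLp_id_gaussianReal (μ := 0) (v := 1) 1).integrable (by norm_num)
    exact (hmp k).integrable_comp_of_integrable h
  have hzero : ∫ g, g i ∂(stdGauss I) = 0 := by
    have h := integral_map (μ := stdGauss I) (hmp i).measurable.aemeasurable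
      (f := fun x : ℝ => x) (by fun_prop)
    rw [(hmp i).map_eq, integral_id_gaussianReal] at h
    exact h.symm
  refine ⟨(hind.indepFun hij).integrable_mul (h_exp i) (h_exp j), ?_⟩
  have h := (hind.indepFun hij).integral_fun_mul_eq_mul_integral
    (h_exp i).aestronglyMeasurable (h_exp j).aestronglyMeasurable
  rw [h, hzero, zero_mul]

lemma one_le_lintegral_exp {Ω : Type*} [MeasurableSpace Ω] {P : Measure Ω} [IsProbabilityMeasure P]
    {q : Ω → ℝ} (hq : Integrable q P) (h0 : ∫ ω, q ω ∂P = 0) :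
    1 ≤ ∫⁻ ω, ENNReal.ofReal (exp (q ω)) ∂P := by
  by_cases hfin : ∫⁻ ω, ENNReal.ofReal (exp (q ω)) ∂P = ⊤
  · simp [hfin]
  have h_exp : Integrable (fun ω => exp (q ω)) P := by
    refine ⟨(Real.continuous_exp.comp_aestronglyMeasurable hq.aestronglyMeasurable), ?_⟩
    rw [hasFiniteIntegral_iff_ofReal (ae_of_all _ fun ω => (exp_pos _).le)]
    exact lt_top_iff_ne_top.2 hfin
  rw [← ofReal_integral_eq_lintegral_ofReal h_exp (ae_of_all _ fun ω => (exp_pos _).le),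
    ← ENNReal.ofReal_one]
  refine ENNReal.ofReal_le_ofReal ?_
  have h1 : ∫ ω, (q ω + 1) ∂P ≤ ∫ ω, exp (q ω) ∂P :=
    integral_mono (hq.add (integrable_const 1)) h_exp fun ω => Real.add_one_le_exp _
  rw [integral_add hq (integrable_const 1), h0] at h1
  simpa using h1

/-- Laplace transform bound for an off-diagonal quadratic form along a permutation. -/
lemma lintegral_exp_chaos_le (Φ : Equiv.Perm I) (x : I → ℝ) (hxΦ : ∀ i, x (Φ i) = x i)
    (hfix : ∀ i, Φ i = i → x i = 0) (hx : ∀ i, x i ^ 2 ≤ 1 / 8) :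
    ∫⁻ g, ENNReal.ofReal (exp (∑ i, x i * g i * g (Φ i))) ∂(stdGauss I)
      ≤ ENNReal.ofReal (exp (∑ i, 4 * x i ^ 2)) := by
  set q : (I → ℝ) → ℝ := fun g => ∑ i, x i * g i * g (Φ i) with hq
  have hqm : Measurable q := by fun_prop
  have hterm : ∀ i, Integrable (fun g : I → ℝ => x i * g i * g (Φ i)) (stdGauss I) ∧
      ∫ g, x i * g i * g (Φ i) ∂(stdGauss I) = 0 := by
    intro i
    by_cases h : Φ i = i
    · simp [hfix i h]
    · obtain ⟨h1, h2⟩ := integrable_mul_and_integral_mul_stdGauss (Ne.symm h)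
      simp_rw [mul_assoc]
      exact ⟨h1.const_mul _, by rw [integral_const_mul, h2, mul_zero]⟩
  have hqi : Integrable q (stdGauss I) := integrable_finsetSum _ fun i _ => (hterm i).1
  have hq0 : ∫ g, -q g ∂(stdGauss I) = 0 := by
    rw [integral_neg, hq, integral_finsetSum _ fun i _ => (hterm i).1]
    simp [hterm]
  have hsplit : ∀ g : I → ℝ, (∑ i, (x i * (g (Φ i) + g (Φ.symm i))) ^ 2 / 2)
      ≤ ∑ i, -(-(2 * x i ^ 2)) * g i ^ 2 := by
    intro g
    have e1 : ∑ i, x i ^ 2 * g (Φ i) ^ 2 = ∑ i, x i ^ 2 * g i ^ 2 := by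
      rw [← Equiv.sum_comp Φ fun i => x i ^ 2 * g i ^ 2]; simp [hxΦ]
    have e2 : ∑ i, x i ^ 2 * g (Φ.symm i) ^ 2 = ∑ i, x i ^ 2 * g i ^ 2 := by
      rw [← Equiv.sum_comp Φ]; simp [hxΦ]
    calc (∑ i, (x i * (g (Φ i) + g (Φ.symm i))) ^ 2 / 2)
        ≤ ∑ i, (x i ^ 2 * g (Φ i) ^ 2 + x i ^ 2 * g (Φ.symm i) ^ 2) := by
          refine Finset.sum_le_sum fun i _ => ?_
          nlinarith [sq_nonneg (x i * (g (Φ i) - g (Φ.symm i)))]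
      _ = ∑ i, -(-(2 * x i ^ 2)) * g i ^ 2 := by
          rw [Finset.sum_add_distrib, e1, e2, ← Finset.sum_add_distrib]
          exact Finset.sum_congr rfl fun i _ => by ring
  calc ∫⁻ g, ENNReal.ofReal (exp (q g)) ∂(stdGauss I)
      ≤ (∫⁻ g, ENNReal.ofReal (exp (q g)) ∂(stdGauss I)) *
          ∫⁻ g, ENNReal.ofReal (exp (-q g)) ∂(stdGauss I) :=
        le_mul_of_one_le_right' (one_le_lintegral_exp hqi.neg hq0)
    _ = ∫⁻ p, ENNReal.ofReal (exp (q p.1)) * ENNReal.ofReal (exp (-q p.2))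
          ∂((stdGauss I).prod (stdGauss I)) :=
        (lintegral_prod_mul (by fun_prop) (by fun_prop)).symm
    _ = ∫⁻ p, ENNReal.ofReal (exp (∑ i, x i * (p.1 (Φ i) + p.1 (Φ.symm i)) * p.2 i))
          ∂((stdGauss I).prod (stdGauss I)) := by
        rw [← measurePreserving_rotation_stdGauss.lintegral_comp (by fun_prop)]
        refine lintegral_congr fun p => ?_
        rw [← ENNReal.ofReal_mul (exp_pos _).le, ← Real.exp_add]
        congr 2
        have e : ∑ i, x i * p.1 (Φ.symm i) * p.2 i = ∑ i, x i * p.1 i * p.2 (Φ i) := by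
          rw [← Equiv.sum_comp Φ]; simp [hxΦ]
        have e' : ∑ i, x i * (p.1 (Φ i) + p.1 (Φ.symm i)) * p.2 i
            = ∑ i, x i * p.1 (Φ i) * p.2 i + ∑ i, x i * p.1 (Φ.symm i) * p.2 i := by
          rw [← Finset.sum_add_distrib]; exact Finset.sum_congr rfl fun i _ => by ring
        rw [e', e]
        simp only [hq]
        rw [← Finset.sum_neg_distrib, ← Finset.sum_add_distrib, ← Finset.sum_add_distrib]
        refine Finset.sum_congr rfl fun i _ => ?_
        have h2 : √2 * √2 = 2 := Real.mul_self_sqrt zero_le_two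
        linear_combination (x i / 2 * (p.1 i * p.2 (Φ i) + p.2 i * p.1 (Φ i))) * h2
    _ = ∫⁻ g, ENNReal.ofReal (exp (∑ i, (x i * (g (Φ i) + g (Φ.symm i))) ^ 2 / 2))
          ∂(stdGauss I) := by
        rw [lintegral_prod _ (by fun_prop)]
        exact lintegral_congr fun g =>
          lintegral_exp_linear fun i => x i * (g (Φ i) + g (Φ.symm i))
    _ ≤ ∫⁻ g, ENNReal.ofReal (exp (∑ i, -(-(2 * x i ^ 2)) * g i ^ 2)) ∂(stdGauss I) :=
        lintegral_mono fun g => ENNReal.ofReal_le_ofReal (Real.exp_le_exp.2 (hsplit g))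
    _ ≤ ENNReal.ofReal (exp (∑ i, (-(-(2 * x i ^ 2)) + 2 * (-(2 * x i ^ 2)) ^ 2))) :=
        lintegral_exp_neg_sum_sq_le _ fun i => by linarith [hx i]
    _ ≤ ENNReal.ofReal (exp (∑ i, 4 * x i ^ 2)) := by
        refine ENNReal.ofReal_le_ofReal (Real.exp_le_exp.2 (Finset.sum_le_sum fun i _ => ?_))
        nlinarith [hx i, sq_nonneg (x i)]

end Chaos

end CGM

namespace CGM

section TailBounds

lemma measure_le_of_lintegral_exp_le {Ω : Type*} [MeasurableSpace Ω] {P : Measure Ω}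
    {X : Ω → ℝ} (hX : Measurable X) {β : ℝ} (t : ℝ)
    (h : ∫⁻ ω, ENNReal.ofReal (exp (X ω)) ∂P ≤ ENNReal.ofReal (exp β)) :
    P {ω | t ≤ X ω} ≤ ENNReal.ofReal (exp (β - t)) := by
  have h1 := meas_ge_le_lintegral_div (μ := P) (f := fun ω => ENNReal.ofReal (exp (X ω)))
    (by fun_prop) (ε := ENNReal.ofReal (exp t)) (by simp [exp_pos]) ENNReal.ofReal_ne_top
  have h2 : {ω | t ≤ X ω} = {ω | ENNReal.ofReal (exp t) ≤ ENNReal.ofReal (exp (X ω))} := by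
    ext ω
    simp [ENNReal.ofReal_le_ofReal_iff (exp_pos _).le]
  rw [h2, Real.exp_sub, ENNReal.ofReal_div_of_pos (exp_pos t)]
  exact h1.trans (ENNReal.div_le_div_right h _)

lemma lintegral_exp_add_le {Ω : Type*} [MeasurableSpace Ω] {P : Measure Ω} {a b : Ω → ℝ}
    (ha : Measurable a) (hb : Measurable b) {α β : ℝ}
    (h1 : ∫⁻ ω, ENNReal.ofReal (exp (2 * a ω)) ∂P ≤ ENNReal.ofReal (exp α))
    (h2 : ∫⁻ ω, ENNReal.ofReal (exp (2 * b ω)) ∂P ≤ ENNReal.ofReal (exp β)) :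
    ∫⁻ ω, ENNReal.ofReal (exp (a ω + b ω)) ∂P ≤ ENNReal.ofReal (exp ((α + β) / 2)) := by
  have h := ENNReal.lintegral_mul_le_Lp_mul_Lq P Real.HolderConjugate.two_two
    (f := fun ω => ENNReal.ofReal (exp (a ω))) (g := fun ω => ENNReal.ofReal (exp (b ω)))
    (by fun_prop) (by fun_prop)
  have hsq : ∀ x : ℝ, ENNReal.ofReal (exp x) ^ (2 : ℝ) = ENNReal.ofReal (exp (2 * x)) := fun x => by
    rw [ENNReal.ofReal_rpow_of_pos (exp_pos x), ← Real.exp_mul, mul_comm]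
  have hrt : ∀ x : ℝ, ENNReal.ofReal (exp x) ^ (1 / 2 : ℝ) = ENNReal.ofReal (exp (x / 2)) :=
    fun x => by
      rw [ENNReal.ofReal_rpow_of_pos (exp_pos x), ← Real.exp_mul, mul_one_div]
  simp only [Pi.mul_apply, hsq] at h
  have e : ∀ ω, ENNReal.ofReal (exp (a ω + b ω))
      = ENNReal.ofReal (exp (a ω)) * ENNReal.ofReal (exp (b ω)) := fun ω => by
    rw [Real.exp_add, ENNReal.ofReal_mul (exp_pos _).le]
  simp_rw [e]
  refine h.trans ?_
  rw [add_div, Real.exp_add, ENNReal.ofReal_mul (exp_pos _).le, ← hrt, ← hrt]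
  gcongr

variable {I : Type*} [Fintype I]

lemma lintegral_exp_add_linear {a : (I → ℝ) → ℝ} {c : (I → ℝ) → I → ℝ} (ha : Measurable a)
    (hc : ∀ i, Measurable fun g => c g i) :
    ∫⁻ p, ENNReal.ofReal (exp (a p.1 + ∑ i, c p.1 i * p.2 i)) ∂((stdGauss I).prod (stdGauss I))
      = ∫⁻ g, ENNReal.ofReal (exp (a g + ∑ i, c g i ^ 2 / 2)) ∂(stdGauss I) := by
  have hc' : ∀ i, Measurable fun p : (I → ℝ) × (I → ℝ) => c p.1 i := fun i =>
    (hc i).comp measurable_fst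
  rw [lintegral_prod _ (by fun_prop)]
  refine lintegral_congr fun g => ?_
  simp_rw [Real.exp_add, ENNReal.ofReal_mul (exp_pos _).le]
  rw [lintegral_const_mul _ (by fun_prop), lintegral_exp_linear]

/-- The weighted alignment score of a permutation `Φ` of the coordinates, for a Gaussian vector
`p.1` and its noisy copy `r * p.1 + s * p.2`. -/
def score (w r s : I → ℝ) (Φ : Equiv.Perm I) (p : (I → ℝ) × (I → ℝ)) : ℝ :=
  ∑ i, w i * p.1 i * (r (Φ i) * p.1 (Φ i) + s (Φ i) * p.2 (Φ i))

lemma measurable_score (w r s : I → ℝ) (Φ : Equiv.Perm I) : Measurable (score w r s Φ) := by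
  unfold score; fun_prop

/-- Weights that are at most the correlations `r`, with noise levels `s`. -/
structure Admissible (κ : ℝ) (w r s : I → ℝ) : Prop where
  sq_le : ∀ i, w i ^ 2 ≤ w i * r i
  mul_le : ∀ i, w i * r i ≤ κ
  weight_sq_le : ∀ i, w i ^ 2 ≤ κ ^ 2
  noise_le : ∀ i, s i ^ 2 ≤ 1

variable {κ : ℝ} {w r s : I → ℝ} {Φ : Equiv.Perm I}

lemma measure_score_one_le_score (hκ0 : 0 ≤ κ) (hκ : κ ≤ 1 / 10) (hA : Admissible κ w r s)
    (hw : ∀ i, w (Φ i) = w i) (hr : ∀ i, r (Φ i) = r i) (hs : ∀ i, s (Φ i) = s i)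
    (hfix : ∀ i, Φ i = i → w i = 0) :
    ((stdGauss I).prod (stdGauss I)) {p | score w r s 1 p ≤ score w r s Φ p}
      ≤ ENNReal.ofReal (exp (-((1 - 3 * κ ^ 2) / 4) * ∑ i, w i ^ 2)) := by
  have hκ2 : κ ^ 2 ≤ 1 / 100 := by nlinarith
  set a : (I → ℝ) → ℝ := fun g => ∑ i, 1 / 2 * (w i * r i) * (g i * g (Φ i) - g i ^ 2) with ha
  set c : (I → ℝ) → I → ℝ := fun g i => 1 / 2 * (s i * w i) * (g (Φ.symm i) - g i) with hc
  have hX : ∀ p : (I → ℝ) × (I → ℝ), 1 / 2 * (score w r s Φ p - score w r s 1 p)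
      = a p.1 + ∑ i, c p.1 i * p.2 i := by
    intro p
    have e : ∑ i, 1 / 2 * (s i * w i) * (p.1 (Φ.symm i) * p.2 i)
        = ∑ i, 1 / 2 * (s i * w i) * (p.1 i * p.2 (Φ i)) := by
      rw [← Equiv.sum_comp Φ]; simp [hs, hw]
    have e' : ∑ i, c p.1 i * p.2 i = ∑ i, 1 / 2 * (s i * w i) * (p.1 (Φ.symm i) * p.2 i)
        - ∑ i, 1 / 2 * (s i * w i) * (p.1 i * p.2 i) := by
      rw [← Finset.sum_sub_distrib]; exact Finset.sum_congr rfl fun i _ => by simp only [hc]; ring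
    rw [e', e]
    simp only [score, ha, hr, hs, Equiv.Perm.coe_one, id]
    rw [← Finset.sum_sub_distrib, ← Finset.sum_sub_distrib, ← Finset.sum_add_distrib,
      Finset.mul_sum]
    exact Finset.sum_congr rfl fun i _ => by ring
  have hle : ∀ g : I → ℝ, a g + ∑ i, c g i ^ 2 / 2
      ≤ (∑ i, -(w i ^ 2 / 4) * g i ^ 2) + ∑ i, w i ^ 2 / 4 * g i * g (Φ i) := by
    intro g
    have e1 : ∑ i, c g i ^ 2 / 2 = ∑ i, 1 / 8 * (s i ^ 2 * w i ^ 2) * (g i - g (Φ i)) ^ 2 := by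
      rw [← Equiv.sum_comp Φ]
      exact Finset.sum_congr rfl fun i _ => by simp only [hc, hs, hw, Equiv.symm_apply_apply]; ring
    have e2 : ∀ v : I → ℝ, (∀ i, v (Φ i) = v i) →
        ∑ i, v i * (g i * g (Φ i) - g i ^ 2) = ∑ i, -(v i / 2) * (g i - g (Φ i)) ^ 2 := by
      intro v hv
      have : ∑ i, v i / 2 * g (Φ i) ^ 2 = ∑ i, v i / 2 * g i ^ 2 := by
        rw [← Equiv.sum_comp Φ fun i => v i / 2 * g i ^ 2]; simp [hv]
      rw [← sub_eq_zero, ← Finset.sum_sub_distrib]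
      rw [← sub_eq_zero, ← Finset.sum_sub_distrib] at this
      rw [← this]
      exact Finset.sum_congr rfl fun i _ => by ring
    have e3 : (∑ i, -(w i ^ 2 / 4) * g i ^ 2) + ∑ i, w i ^ 2 / 4 * g i * g (Φ i)
        = ∑ i, w i ^ 2 / 4 * (g i * g (Φ i) - g i ^ 2) := by
      rw [← Finset.sum_add_distrib]; exact Finset.sum_congr rfl fun i _ => by ring
    rw [e3, e2 _ (by simp [hw]), e1, ha]
    simp only
    rw [e2 _ (by simp [hw, hr]), ← Finset.sum_add_distrib]
    refine Finset.sum_le_sum fun i _ => ?_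
    have h1 : s i ^ 2 * w i ^ 2 ≤ w i ^ 2 := mul_le_of_le_one_left (sq_nonneg _) (hA.noise_le i)
    have h2 := hA.sq_le i
    have h3 := mul_nonneg (sub_nonneg.2 h1) (sq_nonneg (g i - g (Φ i)))
    have h4 := mul_nonneg (sub_nonneg.2 h2) (sq_nonneg (g i - g (Φ i)))
    linarith
  have h_exp : ∫⁻ p, ENNReal.ofReal (exp (1 / 2 * (score w r s Φ p - score w r s 1 p)))
      ∂((stdGauss I).prod (stdGauss I))
      ≤ ENNReal.ofReal (exp (-((1 - 3 * κ ^ 2) / 4) * ∑ i, w i ^ 2)) := by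
    simp_rw [hX]
    rw [lintegral_exp_add_linear (by fun_prop) (by fun_prop)]
    refine (lintegral_mono fun g => ENNReal.ofReal_le_ofReal (Real.exp_le_exp.2 (hle g))).trans ?_
    refine (lintegral_exp_add_le (P := stdGauss I)
      (a := fun g => ∑ i, -(w i ^ 2 / 4) * g i ^ 2)
      (b := fun g => ∑ i, w i ^ 2 / 4 * g i * g (Φ i))
      (α := ∑ i, (-(w i ^ 2 / 2) + 2 * (w i ^ 2 / 2) ^ 2))
      (β := ∑ i, 4 * (w i ^ 2 / 2) ^ 2) (by fun_prop) (by fun_prop) ?_ ?_).trans ?_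
    · refine le_trans (le_of_eq ?_)
        (lintegral_exp_neg_sum_sq_le (fun i => w i ^ 2 / 2) fun i => ?_)
      · refine lintegral_congr fun g => ?_
        rw [Finset.mul_sum]
        congr 2
        exact Finset.sum_congr rfl fun i _ => by ring
      · nlinarith [sq_nonneg (w i)]
    · refine le_trans (le_of_eq ?_)
        (lintegral_exp_chaos_le Φ (fun i => w i ^ 2 / 2) (by simp [hw])
          (fun i hi => by simp [hfix i hi]) fun i => ?_)
      · refine lintegral_congr fun g => ?_
        rw [Finset.mul_sum]
        congr 2
        exact Finset.sum_congr rfl fun i _ => by ring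
      · nlinarith [sq_nonneg (w i), hA.weight_sq_le i]
    · refine ENNReal.ofReal_le_ofReal (Real.exp_le_exp.2 ?_)
      rw [← Finset.sum_add_distrib, Finset.sum_div, Finset.mul_sum]
      refine Finset.sum_le_sum fun i _ => ?_
      nlinarith [mul_nonneg (sq_nonneg (w i)) (sub_nonneg.2 (hA.weight_sq_le i))]
  have h := measure_le_of_lintegral_exp_le
    (((measurable_score w r s Φ).sub (measurable_score w r s 1)).const_mul (1 / 2)) 0 h_exp
  rw [sub_zero] at h
  refine (measure_mono fun p hp => ?_).trans h
  simp only [Set.mem_ofPred_eq] at hp ⊢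
  simp only [Pi.sub_apply]
  linarith

lemma measure_le_score (hκ0 : 0 ≤ κ) (hκ : κ ≤ 1 / 10) (hA : Admissible κ w r s)
    [DecidableEq I]
    (hw : ∀ i, w (Φ i) = w i) (hr : ∀ i, r (Φ i) = r i) (hs : ∀ i, s (Φ i) = s i) (t : ℝ) :
    ((stdGauss I).prod (stdGauss I)) {p | t ≤ score w r s Φ p}
      ≤ ENNReal.ofReal (exp ((1 / 2 + κ ^ 2) * (∑ i, w i ^ 2) + 8 * κ * (∑ i, w i * r i)
          + 1 / 2 * (∑ i, if Φ i = i ∧ w i ≠ 0 then 1 else 0) - t)) := by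
  have hκ2 : κ ^ 2 ≤ 1 / 100 := by nlinarith
  set a : (I → ℝ) → ℝ := fun g => ∑ i, w i * r i * g i * g (Φ i) with ha
  set c : (I → ℝ) → I → ℝ := fun g i => s i * w i * g (Φ.symm i) with hc
  have hX : ∀ p : (I → ℝ) × (I → ℝ), score w r s Φ p = a p.1 + ∑ i, c p.1 i * p.2 i := by
    intro p
    have e : ∑ i, c p.1 i * p.2 i = ∑ i, s i * w i * p.1 i * p.2 (Φ i) := by
      rw [← Equiv.sum_comp Φ]; simp [hc, hs, hw]
    rw [e, ← Finset.sum_add_distrib]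
    simp only [score, hr, hs]
    exact Finset.sum_congr rfl fun i _ => by ring
  set x : I → ℝ := fun i => if Φ i = i then 0 else w i * r i with hx
  set b : I → ℝ := fun i => -(s i ^ 2 * w i ^ 2 + if Φ i = i then 2 * (w i * r i) else 0) with hb
  have heq : ∀ g : I → ℝ, a g + ∑ i, c g i ^ 2 / 2
      = (∑ i, -b i / 2 * g i ^ 2) + ∑ i, x i * g i * g (Φ i) := by
    intro g
    have e : ∑ i, c g i ^ 2 / 2 = ∑ i, s i ^ 2 * w i ^ 2 / 2 * g i ^ 2 := by
      rw [← Equiv.sum_comp Φ]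
      exact Finset.sum_congr rfl fun i _ => by simp only [hc, hs, hw, Equiv.symm_apply_apply]; ring
    rw [e, ← Finset.sum_add_distrib, ← Finset.sum_add_distrib]
    refine Finset.sum_congr rfl fun i _ => ?_
    by_cases h : Φ i = i
    · simp only [hb, hx, h, if_true]; ring
    · simp only [hb, hx, h, if_false]; ring
  have hnn : ∀ i, 0 ≤ w i * r i := fun i => (sq_nonneg _).trans (hA.sq_le i)
  have hsw : ∀ i, s i ^ 2 * w i ^ 2 ≤ w i ^ 2 := fun i =>
    mul_le_of_le_one_left (sq_nonneg _) (hA.noise_le i)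
  have hb4 : ∀ i, -(1 / 4) ≤ b i := by
    intro i
    have h1 := hA.mul_le i
    have h2 := hA.weight_sq_le i
    have h3 := hsw i
    simp only [hb]
    split_ifs <;> linarith
  have h_exp : ∫⁻ p, ENNReal.ofReal (exp (score w r s Φ p)) ∂((stdGauss I).prod (stdGauss I))
      ≤ ENNReal.ofReal (exp ((1 / 2 + κ ^ 2) * (∑ i, w i ^ 2) + 8 * κ * (∑ i, w i * r i)
          + 1 / 2 * (∑ i, if Φ i = i ∧ w i ≠ 0 then 1 else 0))) := by
    simp_rw [hX]
    rw [lintegral_exp_add_linear (by fun_prop) (by fun_prop)]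
    simp_rw [heq]
    refine (lintegral_exp_add_le (P := stdGauss I)
      (a := fun g => ∑ i, -b i / 2 * g i ^ 2)
      (b := fun g => ∑ i, x i * g i * g (Φ i))
      (α := ∑ i, (-b i + 2 * b i ^ 2))
      (β := ∑ i, 4 * (2 * x i) ^ 2) (by fun_prop) (by fun_prop) ?_ ?_).trans ?_
    · refine le_trans (le_of_eq ?_) (lintegral_exp_neg_sum_sq_le b hb4)
      refine lintegral_congr fun g => ?_
      rw [Finset.mul_sum]
      congr 2
      exact Finset.sum_congr rfl fun i _ => by ring
    · refine le_trans (le_of_eq ?_)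
        (lintegral_exp_chaos_le Φ (fun i => 2 * x i) (by simp [hx, hw, hr])
          (fun i hi => by simp [hx, hi]) fun i => ?_)
      · refine lintegral_congr fun g => ?_
        rw [Finset.mul_sum]
        congr 2
        exact Finset.sum_congr rfl fun i _ => by ring
      · have h1 := hA.mul_le i
        have h2 := hnn i
        simp only [hx]
        split_ifs
        · norm_num
        · nlinarith
    · refine ENNReal.ofReal_le_ofReal (Real.exp_le_exp.2 ?_)
      rw [← Finset.sum_add_distrib, Finset.sum_div, Finset.mul_sum, Finset.mul_sum,
        Finset.mul_sum, ← Finset.sum_add_distrib, ← Finset.sum_add_distrib]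
      refine Finset.sum_le_sum fun i _ => ?_
      have h1 := hA.mul_le i
      have h2 := hnn i
      have h3 := hA.weight_sq_le i
      have h4 := hsw i
      have h5 : 0 ≤ s i ^ 2 * w i ^ 2 := by positivity
      by_cases h0 : w i = 0
      · simp [hb, hx, h0]
      · by_cases h : Φ i = i
        · have h6 := hb4 i
          have h7 : b i ≤ 0 := by simp only [hb, h, if_true]; linarith
          have h8 : b i ^ 2 ≤ 1 / 16 := by nlinarith
          simp only [hx, h, h0, if_true, ne_eq, not_false_eq_true, and_self]
          have : 0 ≤ κ * (w i * r i) := mul_nonneg hκ0 h2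
          have : 0 ≤ κ ^ 2 * w i ^ 2 := by positivity
          nlinarith [sq_nonneg (w i)]
        · simp only [hx, hb, h, if_false, false_and, add_zero, mul_zero, neg_neg]
          have h6 : (w i * r i) ^ 2 ≤ κ * (w i * r i) := by nlinarith
          have h7 : (s i ^ 2 * w i ^ 2) ^ 2 ≤ κ ^ 2 * w i ^ 2 := by nlinarith
          linarith [h6, h7]
  exact measure_le_of_lintegral_exp_le (measurable_score w r s Φ) t h_exp

lemma measure_score_one_le (hκ : κ ≤ 1 / 10) (hA : Admissible κ w r s)
    {δ : ℝ} (hδ0 : 0 ≤ δ) (hδ : δ ≤ 1) :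
    ((stdGauss I).prod (stdGauss I)) {p | score w r s 1 p ≤ (1 - δ) * ∑ i, w i * r i}
      ≤ ENNReal.ofReal (exp (-(δ ^ 2 / 4) * ∑ i, w i * r i)) := by
  set a : (I → ℝ) → ℝ := fun g => ∑ i, -(δ / 2) * (w i * r i) * g i ^ 2 with ha
  set c : (I → ℝ) → I → ℝ := fun g i => -(δ / 2) * (s i * w i) * g i with hc
  have hX : ∀ p : (I → ℝ) × (I → ℝ), -(δ / 2) * score w r s 1 p
      = a p.1 + ∑ i, c p.1 i * p.2 i := by
    intro p
    rw [← Finset.sum_add_distrib, score, Finset.mul_sum]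
    exact Finset.sum_congr rfl fun i _ => by simp only [hc, Equiv.Perm.coe_one, id]; ring
  set b : I → ℝ := fun i => δ / 2 * (w i * r i) - δ ^ 2 / 8 * (s i ^ 2 * w i ^ 2) with hb
  have heq : ∀ g : I → ℝ, a g + ∑ i, c g i ^ 2 / 2 = ∑ i, -b i * g i ^ 2 := by
    intro g
    rw [← Finset.sum_add_distrib]
    exact Finset.sum_congr rfl fun i _ => by simp only [hc, hb]; ring
  have hnn : ∀ i, 0 ≤ w i * r i := fun i => (sq_nonneg _).trans (hA.sq_le i)
  have hsw : ∀ i, s i ^ 2 * w i ^ 2 ≤ w i * r i := fun i =>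
    (mul_le_of_le_one_left (sq_nonneg _) (hA.noise_le i)).trans (hA.sq_le i)
  have hb1 : ∀ i, (δ / 2 - δ ^ 2 / 8) * (w i * r i) ≤ b i := by
    intro i
    have := mul_nonneg (sq_nonneg δ) (sub_nonneg.2 (hsw i))
    simp only [hb]; linarith
  have hb2 : ∀ i, b i ≤ δ / 2 * (w i * r i) := by
    intro i
    have : 0 ≤ δ ^ 2 / 8 * (s i ^ 2 * w i ^ 2) := by positivity
    simp only [hb]; linarith
  have hb0 : ∀ i, 0 ≤ b i := fun i =>
    (mul_nonneg (by nlinarith) (hnn i)).trans (hb1 i)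
  have h_exp : ∫⁻ p, ENNReal.ofReal (exp (-(δ / 2) * score w r s 1 p))
      ∂((stdGauss I).prod (stdGauss I))
      ≤ ENNReal.ofReal (exp (∑ i, (-b i + 2 * b i ^ 2))) := by
    simp_rw [hX]
    rw [lintegral_exp_add_linear (by fun_prop) (by fun_prop)]
    simp_rw [heq]
    exact lintegral_exp_neg_sum_sq_le b fun i => by linarith [hb0 i]
  have h := measure_le_of_lintegral_exp_le ((measurable_score w r s 1).const_mul (-(δ / 2)))
    (-(δ / 2) * ((1 - δ) * ∑ i, w i * r i)) h_exp
  refine (measure_mono fun p hp => ?_).trans (h.trans ?_)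
  · simp only [Set.mem_ofPred_eq] at hp ⊢
    nlinarith
  · refine ENNReal.ofReal_le_ofReal (Real.exp_le_exp.2 ?_)
    rw [Finset.mul_sum, Finset.mul_sum, Finset.mul_sum, ← Finset.sum_sub_distrib]
    refine Finset.sum_le_sum fun i _ => ?_
    have h1 := hb1 i
    have h2 := hb2 i
    have h3 := hb0 i
    have h4 := hA.mul_le i
    have h5 := hnn i
    have h6 : b i ^ 2 ≤ (δ / 2 * (w i * r i)) ^ 2 := pow_le_pow_left₀ h3 h2 2
    have h7 : (δ / 2 * (w i * r i)) ^ 2 ≤ δ ^ 2 / 40 * (w i * r i) := by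
      have : (w i * r i) ^ 2 ≤ 1 / 10 * (w i * r i) := by nlinarith
      nlinarith [sq_nonneg δ]
    nlinarith [mul_nonneg (sq_nonneg δ) h5]

end TailBounds

end CGM

namespace CGM

section Coordinates

variable {n d : ℕ}

/-- Index set of the observed pairs: unordered pairs of users, and (user, feature) pairs. -/
abbrev Coord (n d : ℕ) := Sym2 (Fin n) ⊕ (Fin n × Fin d)

/-- The permutation of unordered pairs induced by a permutation of the vertices. -/
def sym2Perm (φ : Equiv.Perm (Fin n)) : Equiv.Perm (Sym2 (Fin n)) where
  toFun := Sym2.map φ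
  invFun := Sym2.map φ.symm
  left_inv e := by simp [Sym2.map_map]
  right_inv e := by simp [Sym2.map_map]

/-- The action of a permutation of the users on all coordinates. -/
def coordPerm (d : ℕ) (φ : Equiv.Perm (Fin n)) : Equiv.Perm (Coord n d) :=
  Equiv.sumCongr (sym2Perm φ) (Equiv.prodCongr φ (Equiv.refl (Fin d)))

@[simp] lemma coordPerm_inl (φ : Equiv.Perm (Fin n)) (e : Sym2 (Fin n)) :
    coordPerm d φ (Sum.inl e) = Sum.inl (e.map φ) := rfl

@[simp] lemma coordPerm_inr (φ : Equiv.Perm (Fin n)) (p : Fin n × Fin d) :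
    coordPerm d φ (Sum.inr p) = Sum.inr (φ p.1, p.2) := rfl

lemma coordPerm_one : coordPerm d (1 : Equiv.Perm (Fin n)) = 1 := by
  ext (e | p)
  · simp [Sym2.map_id]
  · simp

/-- Coefficients equal to `a` on the graph coordinates and to `b` on the feature coordinates. -/
def coef (a b : ℝ) : Coord n d → ℝ := Sum.elim (fun _ => a) (fun _ => b)

@[simp] lemma coef_inl (a b : ℝ) (e : Sym2 (Fin n)) : coef (d := d) a b (Sum.inl e) = a := rfl

@[simp] lemma coef_inr (a b : ℝ) (p : Fin n × Fin d) : coef a b (Sum.inr p) = b := rfl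

lemma coef_coordPerm (a b : ℝ) (φ : Equiv.Perm (Fin n)) (i : Coord n d) :
    coef a b (coordPerm d φ i) = coef a b i := by
  rcases i with e | p <;> simp

/-- A coordinate touches `D` if it involves a user of `D`. -/
def Touches (D : Finset (Fin n)) : Coord n d → Prop :=
  Sum.elim (fun e => ∃ a ∈ D, a ∈ e) (fun p => p.1 ∈ D)

@[simp] lemma touches_inl (D : Finset (Fin n)) (e : Sym2 (Fin n)) :
    Touches (d := d) D (Sum.inl e) ↔ ∃ a ∈ D, a ∈ e := Iff.rfl

@[simp] lemma touches_inr (D : Finset (Fin n)) (p : Fin n × Fin d) :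
    Touches D (Sum.inr p) ↔ p.1 ∈ D := Iff.rfl

lemma touches_coordPerm (φ : Equiv.Perm (Fin n)) (i : Coord n d) :
    Touches φ.support (coordPerm d φ i) ↔ Touches φ.support i := by
  rcases i with e | p
  · simp only [coordPerm_inl, touches_inl, Sym2.mem_map]
    constructor
    · rintro ⟨a, ha, b, hb, rfl⟩
      exact ⟨b, Equiv.Perm.apply_mem_support.1 ha, hb⟩
    · rintro ⟨a, ha, hb⟩
      exact ⟨φ a, Equiv.Perm.apply_mem_support.2 ha, a, hb, rfl⟩
  · simp only [coordPerm_inr, touches_inr, Equiv.Perm.apply_mem_support]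

lemma coordPerm_eq_of_not_touches {φ : Equiv.Perm (Fin n)} {i : Coord n d}
    (h : ¬Touches φ.support i) : coordPerm d φ i = i := by
  rcases i with e | p
  · simp only [touches_inl, not_exists, not_and] at h
    rw [coordPerm_inl]
    congr 1
    refine (Sym2.map_congr (g := id) fun a ha => ?_).trans (by rw [Sym2.map_id, id])
    by_contra hne
    exact h a (Equiv.Perm.mem_support.2 hne) ha
  · simp only [touches_inr, Equiv.Perm.notMem_support] at h
    simp [h]

open Classical in
/-- The weights `w`, restricted to the coordinates touching `D`. -/
def restrict (D : Finset (Fin n)) (w : Coord n d → ℝ) : Coord n d → ℝ :=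
  fun i => if Touches D i then w i else 0

lemma sum_fixed_le (φ : Equiv.Perm (Fin n)) (w : Coord n d → ℝ) :
    (∑ i, if coordPerm d φ i = i ∧ restrict φ.support w i ≠ 0 then (1 : ℝ) else 0)
      ≤ φ.support.card := by
  rw [Finset.sum_boole]
  norm_cast
  refine (Finset.card_le_card (t := φ.support.image fun a => Sum.inl s(a, φ a)) ?_).trans
    Finset.card_image_le
  intro i hi
  rw [Finset.mem_filter] at hi
  rcases i with e | p
  · simp only [ Finset.mem_univ, true_and, restrict, ite_eq_right_iff,
      Classical.not_imp, coordPerm_inl, Sum.inl.injEq, touches_inl] at hi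
    obtain ⟨hfix, ⟨a, ha, hae⟩, -⟩ := hi
    obtain ⟨b, rfl⟩ := Sym2.mem_iff_exists.1 hae
    simp only [Finset.mem_image]
    refine ⟨a, ha, ?_⟩
    have ha' : φ a ≠ a := Equiv.Perm.mem_support.1 ha
    rw [Sym2.map_mk, Sym2.eq_iff] at hfix
    rcases hfix with ⟨h, -⟩ | ⟨h, -⟩
    · exact absurd h ha'
    · rw [h]
  · simp only [Finset.mem_univ, true_and, restrict, ite_eq_right_iff,
      Classical.not_imp, coordPerm_inr, Sum.inr.injEq, touches_inr] at hi
    obtain ⟨hfix, hD, -⟩ := hi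
    exact absurd (congrArg Prod.fst hfix) (Equiv.Perm.mem_support.1 hD)

open Classical in
lemma le_card_touching_edges (D : Finset (Fin n)) :
    (D.card : ℝ) * (n - D.card / 2)
      ≤ ((Finset.univ.filter fun e : Sym2 (Fin n) => ∃ a ∈ D, a ∈ e).card : ℝ) := by
  have h1 : (Finset.univ.filter fun e : Sym2 (Fin n) => ¬∃ a ∈ D, a ∈ e) = Dᶜ.sym2 := by
    ext e
    simp only [Finset.mem_filter, Finset.mem_univ, true_and, Finset.mem_sym2_iff,
      Finset.mem_compl, not_exists, not_and]
    exact ⟨fun h a hae haD => h a haD hae, fun h a haD hae => h a hae haD⟩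
  have h2 := Finset.card_filter_add_card_filter_not
    (s := (Finset.univ : Finset (Sym2 (Fin n)))) (fun e => ∃ a ∈ D, a ∈ e)
  rw [h1, Finset.card_sym2, Finset.card_univ, Sym2.card, Finset.card_compl, Fintype.card_fin] at h2
  have hk : D.card ≤ n := by simpa using Finset.card_le_univ D
  have h3 : (((n + 1).choose 2 : ℕ) : ℝ) = (n + 1) * n / 2 := by
    rw [Nat.cast_choose_two]; push_cast; ring
  have h4 : (((n - D.card + 1).choose 2 : ℕ) : ℝ) = (n - D.card + 1) * (n - D.card) / 2 := by
    rw [Nat.cast_choose_two]; push_cast [Nat.cast_sub hk]; ring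
  have h5 := congrArg (Nat.cast : ℕ → ℝ) h2
  rw [Nat.cast_add, h3, h4] at h5
  have h6 : (0 : ℝ) ≤ D.card := Nat.cast_nonneg _
  linarith

lemma le_sum_restrict_sq (D : Finset (Fin n)) (u v : ℝ) :
    (D.card : ℝ) * ((n - D.card / 2) * u ^ 2 + d * v ^ 2)
      ≤ ∑ i : Coord n d, restrict D (coef u v) i ^ 2 := by
  classical
  have e1 : ∑ e : Sym2 (Fin n), restrict (d := d) D (coef u v) (Sum.inl e) ^ 2
      = ((Finset.univ.filter fun e : Sym2 (Fin n) => ∃ a ∈ D, a ∈ e).card : ℝ) * u ^ 2 := by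
    simp only [restrict, touches_inl, coef_inl, ite_pow, ne_eq, OfNat.ofNat_ne_zero,
      not_false_eq_true, zero_pow]
    rw [← Finset.sum_filter, Finset.sum_const, nsmul_eq_mul]
  have e2 : ∑ p : Fin n × Fin d, restrict D (coef u v) (Sum.inr p) ^ 2
      = (D.card : ℝ) * d * v ^ 2 := by
    rw [Fintype.sum_prod_type]
    simp only [restrict, touches_inr, coef_inr, ite_pow, ne_eq, OfNat.ofNat_ne_zero,
      not_false_eq_true, zero_pow, Finset.sum_const, Finset.card_univ, Fintype.card_fin,
      smul_ite, smul_zero, nsmul_eq_mul]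
    simp [mul_assoc]
  rw [Fintype.sum_sum_type, e1, e2]
  have := mul_le_mul_of_nonneg_right (le_card_touching_edges D) (sq_nonneg u)
  linarith

lemma Admissible.ite {I : Type*} [Fintype I] {κ : ℝ} {w r s : I → ℝ} (h : Admissible κ w r s)
    (hκ : 0 ≤ κ) (p : I → Prop) [DecidablePred p] :
    Admissible κ (fun i => if p i then w i else 0) r s where
  sq_le i := by split_ifs <;> simp [h.sq_le]
  mul_le i := by split_ifs <;> simp [h.mul_le, hκ]
  weight_sq_le i := by split_ifs <;> simp [h.weight_sq_le, sq_nonneg]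
  noise_le := h.noise_le

lemma score_sub_score_congr {I : Type*} [Fintype I] {w w' r s : I → ℝ} {Φ : Equiv.Perm I}
    (h : ∀ i, Φ i ≠ i → w i = w' i) (p : (I → ℝ) × (I → ℝ)) :
    score w r s Φ p - score w r s 1 p = score w' r s Φ p - score w' r s 1 p := by
  simp only [score]
  rw [← Finset.sum_sub_distrib, ← Finset.sum_sub_distrib]
  refine Finset.sum_congr rfl fun i _ => ?_
  by_cases hi : Φ i = i
  · simp [hi]
  · rw [h i hi]

lemma setOf_score_congr {I : Type*} [Fintype I] {w w' r s : I → ℝ} {Φ : Equiv.Perm I}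
    (h : ∀ i, Φ i ≠ i → w i = w' i) :
    {p | score w r s 1 p ≤ score w r s Φ p} = {p | score w' r s 1 p ≤ score w' r s Φ p} := by
  ext p
  rw [Set.mem_ofPred_eq, Set.mem_ofPred_eq, ← sub_nonneg, score_sub_score_congr h, sub_nonneg]

end Coordinates

end CGM

namespace CGM

section UnionBound

variable {n d : ℕ} {κ ε L u v : ℝ} {r s : Coord n d → ℝ}

/-- Truncated weights `u`, `v` that stay admissible while carrying the signal `4 (1 + ε) L`. -/
structure Regime (κ ε L : ℝ) (n d : ℕ) (u v : ℝ) (r s : Coord n d → ℝ) : Prop where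
  eps_pos : 0 < ε
  eps_le : ε ≤ 1
  kappa_eq : κ = ε / 100
  admissible : Admissible κ (coef u v) r s
  corr_invariant : ∀ φ i, r (coordPerm d φ i) = r i
  noise_invariant : ∀ φ i, s (coordPerm d φ i) = s i
  signal : 4 * (1 + ε) * L ≤ u ^ 2 * n + v ^ 2 * d
  le_eps_mul : 5 ≤ ε * L
  le_kappa_mul : 4 ≤ κ ^ 3 * L

lemma measure_score_le_of_small (h : Regime κ ε L n d u v r s) (φ : Equiv.Perm (Fin n))
    (hk : (φ.support.card : ℝ) ≤ κ * n) :
    ((stdGauss (Coord n d)).prod (stdGauss (Coord n d)))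
        {p | score (coef u v) r s 1 p ≤ score (coef u v) r s (coordPerm d φ) p}
      ≤ ENNReal.ofReal (exp (-((1 + ε / 2) * (φ.support.card * L)))) := by
  classical
  obtain ⟨h0, h1, rfl, hA, hr, hs, hsig, h5, -⟩ := h
  set κ := ε / 100 with hκ
  set Φ := coordPerm d φ with hΦ
  set w : Coord n d → ℝ := coef u v with hw
  have hκ0 : 0 ≤ κ := by positivity
  let w' : Coord n d → ℝ := fun i => if Φ i ≠ i then w i else 0
  have hA' : Admissible κ w' r s := hA.ite hκ0 fun i => Φ i ≠ i
  rw [setOf_score_congr (w' := w') fun i hi => by simp [w', hi]]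
  refine (measure_score_one_le_score hκ0 (by linarith) hA' (fun i => ?_) (hr φ) (hs φ)
    fun i hi => by simp [w', hΦ, hi]).trans (ENNReal.ofReal_le_ofReal (exp_le_exp.2 ?_))
  · simp only [w', hw, hΦ, coef_coordPerm, ne_eq, EmbeddingLike.apply_eq_iff_eq]
  have hS := le_sum_restrict_sq (d := d) φ.support u v
  have hF := sum_fixed_le (d := d) φ w
  set k : ℝ := (φ.support.card : ℝ)
  set S := ∑ i : Coord n d, restrict φ.support (coef u v) i ^ 2 with hSdef
  have hk0 : 0 ≤ k := Nat.cast_nonneg _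
  have hS' : S - κ ^ 2 * k ≤ ∑ i, w' i ^ 2 := by
    have : S ≤ ∑ i, w' i ^ 2 + κ ^ 2 *
        ∑ i, (if coordPerm d φ i = i ∧ restrict φ.support w i ≠ 0 then (1 : ℝ) else 0) := by
      rw [Finset.mul_sum, ← Finset.sum_add_distrib]
      refine Finset.sum_le_sum fun i _ => ?_
      by_cases hi : Φ i = i
      · by_cases hz : restrict φ.support w i = 0
        · simp [← hw, hz, w', hi]
        · have : restrict φ.support w i ^ 2 ≤ κ ^ 2 := by
            simp only [restrict]
            split_ifs
            · exact hA.weight_sq_le i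
            · simpa using sq_nonneg κ
          simpa [← hw, hz, w', hi, ← hΦ] using this
      · have : restrict φ.support w i = w i := by
          simp only [restrict, ite_eq_left_iff]
          exact fun hT => absurd (coordPerm_eq_of_not_touches hT) hi
        simp [← hw, this, w', hi, ← hΦ]
    nlinarith [sq_nonneg κ]
  have hL : 0 < L := by nlinarith
  have hL1 : 1 ≤ L := by nlinarith
  have hkL : 0 ≤ k * L := by positivity
  have hS2 : k * ((1 - κ) * (4 * (1 + ε) * L)) ≤ S := by
    refine le_trans (mul_le_mul_of_nonneg_left ?_ hk0) hS
    have e1 : (1 - κ) * (4 * (1 + ε) * L) ≤ (1 - κ) * (u ^ 2 * n + v ^ 2 * d) :=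
      mul_le_mul_of_nonneg_left hsig (by linarith)
    have e2 : (1 - κ) * n ≤ n - k / 2 := by linarith
    have e3 := mul_le_mul_of_nonneg_right e2 (sq_nonneg u)
    have e4 : 0 ≤ κ * (v ^ 2 * d) := by positivity
    nlinarith
  have hS3 : 4 * (1 + 9 / 10 * ε) * (k * L) ≤ ∑ i, w' i ^ 2 := by
    have e1 : κ ^ 2 * k ≤ ε / 100 * (k * L) := by
      have : κ ^ 2 ≤ ε / 100 * L := by nlinarith
      nlinarith
    have e2 : (4 * (1 + 9 / 10 * ε) + ε / 100) * (k * L) ≤ (1 - κ) * (4 * (1 + ε)) * (k * L) :=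
      mul_le_mul_of_nonneg_right (by nlinarith) hkL
    nlinarith
  have hκ2 : 3 * κ ^ 2 ≤ ε / 100 := by nlinarith
  have e3 : (1 - ε / 100) * (4 * (1 + 9 / 10 * ε) * (k * L))
      ≤ (1 - 3 * κ ^ 2) * ∑ i, w' i ^ 2 :=
    mul_le_mul (by linarith) hS3 (by positivity) (by linarith)
  have e4 : (4 * (1 + ε / 2)) * (k * L) ≤ ((1 - ε / 100) * (4 * (1 + 9 / 10 * ε))) * (k * L) :=
    mul_le_mul_of_nonneg_right (by nlinarith) hkL
  linarith

/-- The event that the total score of the true alignment, over the coordinates touching `D`,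
falls below its mean by a factor `1 - κ`. -/
def deficient (κ : ℝ) (w r s : Coord n d → ℝ) (D : Finset (Fin n)) :
    Set ((Coord n d → ℝ) × (Coord n d → ℝ)) :=
  {p | score (restrict D w) r s 1 p ≤ (1 - κ) * ∑ i, restrict D w i * r i}

lemma Admissible.restrict {w : Coord n d → ℝ} (h : Admissible κ w r s) (hκ : 0 ≤ κ)
    (D : Finset (Fin n)) : Admissible κ (restrict D w) r s := by
  classical exact h.ite hκ (Touches D)

lemma Regime.le_sum_sq (h : Regime κ ε L n d u v r s) (D : Finset (Fin n)) :
    2 * (1 + ε) * (D.card * L) ≤ ∑ i : Coord n d, CGM.restrict D (coef u v) i ^ 2 := by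
  have hS := le_sum_restrict_sq (d := d) D u v
  have hk : (D.card : ℝ) ≤ n := by
    exact_mod_cast (Finset.card_le_univ D).trans_eq (Fintype.card_fin n)
  have hk0 : (0 : ℝ) ≤ D.card := Nat.cast_nonneg _
  have e1 : (4 * (1 + ε) * L) / 2 ≤ (n - D.card / 2) * u ^ 2 + d * v ^ 2 := by
    have e2 := mul_le_mul_of_nonneg_right (show (n : ℝ) / 2 ≤ n - D.card / 2 by linarith)
      (sq_nonneg u)
    have e3 : 0 ≤ v ^ 2 * d := by positivity
    linarith [h.signal]
  linarith [mul_le_mul_of_nonneg_left e1 hk0]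

lemma measure_deficient_le (h : Regime κ ε L n d u v r s) {D : Finset (Fin n)}
    (hD : κ * n < D.card) :
    ((stdGauss (Coord n d)).prod (stdGauss (Coord n d))) (deficient κ (coef u v) r s D)
      ≤ ENNReal.ofReal (exp (-(2 * n))) := by
  have hS := h.le_sum_sq D
  obtain ⟨h0, h1, rfl, hA, hr, hs, hsig, h5, h4⟩ := h
  have hκ0 : 0 ≤ ε / 100 := by positivity
  refine (measure_score_one_le (by linarith) (hA.restrict hκ0 D) hκ0 (by linarith)).trans
    (ENNReal.ofReal_le_ofReal (exp_le_exp.2 ?_))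
  have hW : ∑ i : Coord n d, CGM.restrict D (coef u v) i ^ 2
      ≤ ∑ i, CGM.restrict D (coef u v) i * r i :=
    Finset.sum_le_sum fun i _ => (hA.restrict hκ0 D).sq_le i
  have hL : 0 < L := by nlinarith
  set κ := ε / 100
  set k : ℝ := (D.card : ℝ)
  have hn : (0 : ℝ) ≤ n := Nat.cast_nonneg _
  have e1 : κ * n * L ≤ k * L := mul_le_mul_of_nonneg_right hD.le hL.le
  have e0 : 0 ≤ κ * n * L := by positivity
  have e2 : 2 * (κ * n * L) ≤ ∑ i, CGM.restrict D (coef u v) i * r i := by nlinarith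
  have e3 := mul_le_mul_of_nonneg_left e2 (show 0 ≤ κ ^ 2 / 4 by positivity)
  have e4 := mul_le_mul_of_nonneg_right h4 hn
  nlinarith

lemma measure_score_le_of_large (h : Regime κ ε L n d u v r s) (φ : Equiv.Perm (Fin n)) :
    ((stdGauss (Coord n d)).prod (stdGauss (Coord n d)))
        ({p | score (coef u v) r s 1 p ≤ score (coef u v) r s (coordPerm d φ) p}
          \ deficient κ (coef u v) r s φ.support)
      ≤ ENNReal.ofReal (exp (-((1 + ε / 2) * (φ.support.card * L)))) := by
  classical
  have hS := h.le_sum_sq φ.support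
  obtain ⟨h0, h1, rfl, hA, hr, hs, hsig, h5, -⟩ := h
  have hκ0 : 0 ≤ ε / 100 := by positivity
  have hA' := hA.restrict hκ0 φ.support
  have hF := sum_fixed_le (d := d) φ (coef u v)
  have hW : ∑ i : Coord n d, CGM.restrict φ.support (coef u v) i ^ 2
      ≤ ∑ i, CGM.restrict φ.support (coef u v) i * r i :=
    Finset.sum_le_sum fun i _ => hA'.sq_le i
  set w := CGM.restrict φ.support (coef (n := n) (d := d) u v) with hw
  set κ := ε / 100 with hκ
  rw [setOf_score_congr (w' := w) fun i hi => by
    simp only [hw, CGM.restrict]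
    rw [if_pos (by_contra fun hT => hi (coordPerm_eq_of_not_touches hT))]]
  refine (measure_mono (t := {p | (1 - κ) * ∑ i, w i * r i ≤ score w r s (coordPerm d φ) p})
    ?_).trans ?_
  · rintro p ⟨hp, hp'⟩
    simp only [deficient, Set.mem_ofPred_eq, not_le] at hp hp' ⊢
    exact hp'.le.trans hp
  refine (measure_le_score hκ0 (by linarith) hA' (fun i => ?_) (hr φ) (hs φ) _).trans
    (ENNReal.ofReal_le_ofReal (exp_le_exp.2 ?_))
  · simp only [hw, CGM.restrict, coef_coordPerm, touches_coordPerm]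
  have hL : 0 < L := by nlinarith
  set k : ℝ := (φ.support.card : ℝ)
  have hk0 : 0 ≤ k := Nat.cast_nonneg _
  set S := ∑ i, w i ^ 2
  set W := ∑ i, w i * r i
  have hkL : 0 ≤ k * L := by positivity
  have e1 : (1 - 9 * κ) * S ≤ (1 - 9 * κ) * W := mul_le_mul_of_nonneg_left hW (by linarith)
  have hκ2 : κ ^ 2 ≤ κ / 100 := by nlinarith
  have e2 : (1 / 2 - 10 * κ) * (2 * (1 + ε) * (k * L)) ≤ (1 / 2 - 9 * κ - κ ^ 2) * S :=
    mul_le_mul (by linarith) hS (by positivity) (by nlinarith)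
  have e3 : k / 2 ≤ ε / 10 * (k * L) := by nlinarith
  have e4 : (1 + ε / 2 + ε / 10) * (k * L) ≤ ((1 / 2 - 10 * κ) * (2 * (1 + ε))) * (k * L) :=
    mul_le_mul_of_nonneg_right (by nlinarith) hkL
  linarith

lemma card_filter_support_eq_le (D : Finset (Fin n)) :
    (Finset.univ.filter fun φ : Equiv.Perm (Fin n) => φ.support = D).card ≤ D.card.factorial := by
  have h : Fintype.card {f : Equiv.Perm (Fin n) // ∀ a, ¬(a ∈ D) → f a = a} = D.card.factorial := by
    rw [← Fintype.card_congr (Equiv.Perm.subtypeEquivSubtypePerm (· ∈ D)), Fintype.card_perm,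
      Fintype.card_coe]
  rw [← h, Fintype.card_subtype]
  refine Finset.card_le_card fun φ hφ => ?_
  simp only [Finset.mem_filter, Finset.mem_univ, true_and] at hφ ⊢
  subst hφ
  exact fun a ha => Equiv.Perm.notMem_support.1 ha

lemma measure_exists_support_eq_le (h : Regime κ ε L n d u v r s) (D : Finset (Fin n)) :
    ((stdGauss (Coord n d)).prod (stdGauss (Coord n d)))
        {p | ∃ φ : Equiv.Perm (Fin n), φ.support = D ∧
          score (coef u v) r s 1 p ≤ score (coef u v) r s (coordPerm d φ) p}
      ≤ ENNReal.ofReal (D.card.factorial * exp (-((1 + ε / 2) * (D.card * L)))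
        + exp (-(2 * n))) := by
  set P := (stdGauss (Coord n d)).prod (stdGauss (Coord n d))
  set b := exp (-((1 + ε / 2) * (D.card * L))) with hb
  set E := if (D.card : ℝ) ≤ κ * n then ∅ else deficient κ (coef u v) r s D with hE
  have hPE : P E ≤ ENNReal.ofReal (exp (-(2 * n))) := by
    rw [hE]
    split_ifs with hk
    · simp
    · exact measure_deficient_le h (not_le.1 hk)
  let G : Equiv.Perm (Fin n) → Set ((Coord n d → ℝ) × (Coord n d → ℝ)) := fun φ =>
    {p | score (coef u v) r s 1 p ≤ score (coef u v) r s (coordPerm d φ) p}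
  have hG : ∀ φ ∈ Finset.univ.filter fun φ : Equiv.Perm (Fin n) => φ.support = D,
      P (G φ \ E) ≤ ENNReal.ofReal b := by
    intro φ hφ
    obtain rfl : φ.support = D := by simpa using hφ
    rw [hE]
    split_ifs with hk
    · rw [Set.sdiff_empty]
      exact measure_score_le_of_small h φ hk
    · exact measure_score_le_of_large h φ
  have hsub : {p | ∃ φ : Equiv.Perm (Fin n), φ.support = D ∧
          score (coef u v) r s 1 p ≤ score (coef u v) r s (coordPerm d φ) p}
      ⊆ (⋃ φ ∈ Finset.univ.filter fun φ : Equiv.Perm (Fin n) => φ.support = D, G φ \ E) ∪ E := by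
    rintro p ⟨φ, hφ, hp⟩
    by_cases hpE : p ∈ E
    · exact Or.inr hpE
    · refine Or.inl (Set.mem_biUnion (x := φ) ?_ ⟨hp, hpE⟩)
      simpa using hφ
  rw [ENNReal.ofReal_add (by positivity) (by positivity)]
  refine (measure_mono hsub).trans ((measure_union_le _ _).trans (add_le_add ?_ hPE))
  refine (measure_biUnion_finset_le _ _).trans ((Finset.sum_le_sum hG).trans ?_)
  rw [Finset.sum_const, nsmul_eq_mul, ENNReal.ofReal_mul (by positivity), ENNReal.ofReal_natCast]
  gcongr
  exact card_filter_support_eq_le D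

lemma sum_range_pow_succ_le {y : ℝ} (hy0 : 0 ≤ y) (hy : y ≤ 1 / 2) (m : ℕ) :
    ∑ k ∈ Finset.range m, y ^ (k + 1) ≤ 2 * y := by
  have h1 : ∑ k ∈ Finset.range m, y ^ (k + 1) = y * ∑ k ∈ Finset.range m, y ^ k := by
    rw [Finset.mul_sum]
    exact Finset.sum_congr rfl fun k _ => pow_succ' y k
  have h2 := geom_sum_mul_neg y m
  have h3 : 0 ≤ ∑ k ∈ Finset.range m, y ^ k := Finset.sum_nonneg fun k _ => pow_nonneg hy0 k
  have h4 : 0 ≤ y ^ m := pow_nonneg hy0 m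
  have h5 : ∑ k ∈ Finset.range m, y ^ k ≤ 2 := by nlinarith
  nlinarith

lemma sum_factorial_mul_exp_le (hn : 0 < n) (h5 : 5 ≤ ε * Real.log n) :
    ∑ D : Finset (Fin n), (if D.card = 0 then 0 else
        (D.card.factorial * exp (-((1 + ε / 2) * (D.card * Real.log n))) + exp (-(2 * n))))
      ≤ 2 * exp (-(ε / 2 * Real.log n)) + exp (-n) := by
  set y := exp (-(ε / 2 * Real.log n)) with hy
  have hy2 : y ≤ 1 / 2 := by
    have h1 : y ≤ exp (-1) := exp_le_exp.2 (by linarith)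
    have h2 : exp (-1) ≤ 1 / 2 := by
      have := Real.exp_one_gt_d9
      rw [Real.exp_neg, ← one_div]
      exact one_div_le_one_div_of_le (by norm_num) (by linarith)
    exact h1.trans h2
  have hsplit : ∀ D : Finset (Fin n), (if D.card = 0 then (0 : ℝ) else
        (D.card.factorial * exp (-((1 + ε / 2) * (D.card * Real.log n))) + exp (-(2 * n))))
      ≤ (if D.card = 0 then 0 else
          D.card.factorial * exp (-((1 + ε / 2) * (D.card * Real.log n)))) + exp (-(2 * n)) := by
    intro D
    split_ifs
    · positivity
    · exact le_rfl
  refine (Finset.sum_le_sum fun D _ => hsplit D).trans ?_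
  rw [Finset.sum_add_distrib]
  refine add_le_add ?_ ?_
  · have h := Finset.sum_powerset_apply_card (fun k : ℕ => if k = 0 then (0 : ℝ) else
          k.factorial * exp (-((1 + ε / 2) * (k * Real.log n)))) (x := (Finset.univ : Finset (Fin n)))
    rw [Finset.powerset_univ, Finset.card_univ, Fintype.card_fin] at h
    rw [h, Finset.sum_range_succ']
    simp only [Nat.add_eq_zero_iff, one_ne_zero, and_false, if_false, if_true, smul_zero, add_zero]
    refine le_trans (Finset.sum_le_sum fun k _ => ?_) (sum_range_pow_succ_le (exp_pos _).le hy2 n)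
    have hd : ((n.choose (k + 1) : ℕ) : ℝ) * ((k + 1).factorial : ℝ) ≤ (n : ℝ) ^ (k + 1) := by
      have := Nat.descFactorial_le_pow n (k + 1)
      rw [Nat.descFactorial_eq_factorial_mul_choose, mul_comm] at this
      exact_mod_cast this
    have hp : (n : ℝ) ^ (k + 1) = exp ((k + 1 : ℕ) * Real.log n) := by
      rw [Real.exp_nat_mul, Real.exp_log (by exact_mod_cast hn)]
    rw [nsmul_eq_mul, ← mul_assoc]
    refine (mul_le_mul_of_nonneg_right hd (exp_pos _).le).trans_eq ?_
    rw [hp, ← Real.exp_nat_mul, ← Real.exp_add]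
    congr 1
    ring
  · rw [Finset.sum_const, Finset.card_univ, Fintype.card_finset, Fintype.card_fin, nsmul_eq_mul]
    push_cast
    have h2 : (2 : ℝ) ^ n ≤ exp n := by
      rw [← Real.exp_one_pow]
      exact pow_le_pow_left₀ (by norm_num) (by linarith [Real.exp_one_gt_d9]) n
    refine (mul_le_mul_of_nonneg_right h2 (exp_pos _).le).trans_eq ?_
    rw [← Real.exp_add]
    congr 1
    ring

/-- With high probability no nontrivial permutation beats the true alignment. -/
lemma measure_exists_score_le (h : Regime κ ε (Real.log n) n d u v r s) (hn : 0 < n) :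
    ((stdGauss (Coord n d)).prod (stdGauss (Coord n d)))
        {p | ∃ φ : Equiv.Perm (Fin n), φ ≠ 1 ∧
          score (coef u v) r s 1 p ≤ score (coef u v) r s (coordPerm d φ) p}
      ≤ ENNReal.ofReal (2 * exp (-(ε / 2 * Real.log n)) + exp (-n)) := by
  refine le_trans ?_
    (ENNReal.ofReal_le_ofReal (sum_factorial_mul_exp_le hn h.le_eps_mul))
  rw [ENNReal.ofReal_sum_of_nonneg fun D _ => by split_ifs <;> positivity]
  let F : Finset (Fin n) → Set ((Coord n d → ℝ) × (Coord n d → ℝ)) := fun D =>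
    if D.card = 0 then ∅ else {p | ∃ φ : Equiv.Perm (Fin n), φ.support = D ∧
          score (coef u v) r s 1 p ≤ score (coef u v) r s (coordPerm d φ) p}
  refine (measure_mono (t := ⋃ D ∈ (Finset.univ : Finset (Finset (Fin n))), F D) ?_).trans
    ((measure_biUnion_finset_le _ _).trans (Finset.sum_le_sum fun D _ => ?_))
  · rintro p ⟨φ, hφ, hp⟩
    refine Set.mem_biUnion (x := φ.support) (by simp) ?_
    simp only [F]
    rw [if_neg (by simpa using hφ)]
    exact ⟨φ, rfl, hp⟩
  · simp only [F]
    split_ifs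
    · simp
    · exact measure_exists_support_eq_le h D

end UnionBound

end CGM

namespace CGM

section Transfer

lemma measurePreserving_select {m k : ℕ} {K : Type*} [Fintype K] (σ : K → Fin m × Fin k)
    (hσ : Function.Injective σ) :
    MeasurePreserving (fun (f : Fin m → Fin k → ℝ) i => f (σ i).1 (σ i).2)
      (Measure.pi fun _ => Measure.pi fun _ => gaussianReal 0 1) (stdGauss K) := by
  have h1 : MeasurePreserving (MeasurableEquiv.curry (Fin m) (Fin k) ℝ).symm
      (Measure.pi fun _ => Measure.pi fun _ => gaussianReal 0 1) (stdGauss (Fin m × Fin k)) := by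
    refine ⟨by fun_prop, ?_⟩
    have h := Measure.infinitePi_map_curry_symm (fun (_ : Fin m) (_ : Fin k) => gaussianReal 0 1)
    simpa only [Measure.infinitePi_eq_pi, stdGauss] using h
  have h2 : MeasurePreserving (fun (f : Fin m × Fin k → ℝ) i => f (σ i))
      (stdGauss (Fin m × Fin k)) (stdGauss K) := by
    refine ⟨by fun_prop, ?_⟩
    have hind : iIndepFun (fun (j : Fin m × Fin k) (f : Fin m × Fin k → ℝ) => f j)
        (stdGauss (Fin m × Fin k)) :=
      iIndepFun_pi (X := fun _ x => x) fun _ => aemeasurable_id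
    rw [(iIndepFun_iff_map_fun_eq_pi_map fun i => (measurable_pi_apply (σ i)).aemeasurable).1 (hind.precomp hσ)]
    unfold stdGauss
    congr 1
    ext1 i
    exact (measurePreserving_eval (fun _ => gaussianReal 0 1) (σ i)).map_eq
  exact h2.comp h1

lemma measurePreserving_prod_comm_middle {α β γ δ : Type*} [MeasurableSpace α] [MeasurableSpace β]
    [MeasurableSpace γ] [MeasurableSpace δ] (a : Measure α) (b : Measure β) (c : Measure γ)
    (e : Measure δ) [SFinite a] [SFinite b] [SFinite c] [SFinite e] :
    MeasurePreserving (fun q : (α × β) × (γ × δ) => ((q.1.1, q.2.1), (q.1.2, q.2.2)))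
      ((a.prod b).prod (c.prod e)) ((a.prod c).prod (b.prod e)) := by
  refine ⟨by fun_prop, Measure.ext_of_lintegral _ fun f hf => ?_⟩
  have hf' : ∀ x, Measurable fun q : (γ × β) × δ => f ((x, q.1.1), (q.1.2, q.2)) := fun x => by
    fun_prop
  have h1 : Measurable fun q : (α × β) × (γ × δ) => f ((q.1.1, q.2.1), (q.1.2, q.2.2)) := by
    fun_prop
  rw [lintegral_map hf (by fun_prop), lintegral_prod _ h1.aemeasurable,
    lintegral_prod _ hf.aemeasurable, lintegral_prod _ h1.lintegral_prod_right'.aemeasurable,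
    lintegral_prod _ hf.lintegral_prod_right'.aemeasurable]
  refine lintegral_congr fun x => ?_
  calc ∫⁻ y, ∫⁻ z, f ((x, z.1), y, z.2) ∂c.prod e ∂b
      = ∫⁻ y, ∫⁻ z, ∫⁻ t, f ((x, z), y, t) ∂e ∂c ∂b :=
        lintegral_congr fun y => lintegral_prod _ (by fun_prop)
    _ = ∫⁻ z, ∫⁻ y, ∫⁻ t, f ((x, z), y, t) ∂e ∂b ∂c := by
        refine lintegral_lintegral_swap (Measurable.aemeasurable ?_)
        exact ((hf' x).lintegral_prod_right' (ν := e)).comp measurable_swap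
    _ = ∫⁻ z, ∫⁻ y, f ((x, z), y) ∂b.prod e ∂c :=
        lintegral_congr fun z => by rw [lintegral_prod _ (by fun_prop)]

variable {n d : ℕ}

instance : IsProbabilityMeasure (stdGaussG n) := by unfold stdGaussG; infer_instance

instance : IsProbabilityMeasure (stdGaussF n d) := by unfold stdGaussF; infer_instance

instance : IsProbabilityMeasure (μ n d) := by unfold μ; infer_instance

instance : IsProbabilityMeasure (unifPerm n) := by unfold unifPerm; infer_instance

instance : IsProbabilityMeasure (μU n d) := by unfold μU; infer_instance

/-- The coordinates of a pair of arrays that enter the model. -/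
def gather (f : GW n) (g : FW n d) : Coord n d → ℝ :=
  Sum.elim (fun e => f e.inf e.sup) fun p => g p.1 p.2

/-- The latent Gaussian vectors of a sample: signal and noise. -/
def toCoord (ω : Samp n d) : (Coord n d → ℝ) × (Coord n d → ℝ) :=
  (gather ω.1.1 ω.2.1, gather ω.1.2 ω.2.2)

lemma measurePreserving_gather :
    MeasurePreserving (fun q : GW n × FW n d => gather q.1 q.2)
      ((stdGaussG n).prod (stdGaussF n d)) (stdGauss (Coord n d)) := by
  have hG : MeasurePreserving (fun (f : GW n) (e : Sym2 (Fin n)) => f e.inf e.sup)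
      (stdGaussG n) (stdGauss (Sym2 (Fin n))) :=
    measurePreserving_select (fun e => (e.inf, e.sup)) fun e e' h =>
      Sym2.inf_eq_inf_and_sup_eq_sup.1 (Prod.ext_iff.1 h)
  have hF : MeasurePreserving (fun (g : FW n d) (p : Fin n × Fin d) => g p.1 p.2)
      (stdGaussF n d) (stdGauss (Fin n × Fin d)) :=
    measurePreserving_select id Function.injective_id
  have h := (measurePreserving_sumPiEquivProdPi_symm
    (fun _ : Coord n d => gaussianReal 0 1)).comp (hG.prod hF)
  convert! h using 1

lemma measurePreserving_toCoord :
    MeasurePreserving (toCoord (n := n) (d := d)) (μ n d)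
      ((stdGauss (Coord n d)).prod (stdGauss (Coord n d))) :=
  (measurePreserving_gather.prod measurePreserving_gather).comp
    (measurePreserving_prod_comm_middle (stdGaussG n) (stdGaussG n) (stdGaussF n d) (stdGaussF n d))

end Transfer

section Estimator

variable {n d : ℕ}

/-- The weighted alignment score of a candidate permutation, computed from the observations. -/
def obsScore (u v : ℝ) (ψ : Equiv.Perm (Fin n)) (o : Obs n d) : ℝ :=
  u * ∑ e : Sym2 (Fin n), o.1 e.inf e.sup * o.2.1 (ψ e.inf) (ψ e.sup)
    + v * ∑ p : Fin n × Fin d, o.2.2.1 p.1 p.2 * o.2.2.2 (ψ p.1) p.2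

lemma measurable_obsScore (u v : ℝ) (ψ : Equiv.Perm (Fin n)) :
    Measurable (obsScore (d := d) u v ψ) := by
  unfold obsScore; fun_prop

lemma sym_apply (f : GW n) (a b : Fin n) : sym f a b = f s(a, b).inf s(a, b).sup := by
  unfold sym
  split_ifs with h
  · simp [h]
  · simp [(not_le.1 h).le]

lemma obsScore_obs (u v ρ η : ℝ) (ψ : Equiv.Perm (Fin n)) (ω : SampU n d) :
    obsScore u v ψ (obs ρ η ω)
      = score (coef u v) (coef ρ η) (coef √(1 - ρ ^ 2) √(1 - η ^ 2))
        (coordPerm d (ω.2⁻¹ * ψ)) (toCoord ω.1) := by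
  unfold obsScore score
  rw [Fintype.sum_sum_type, Finset.mul_sum, Finset.mul_sum]
  congr 1
  · refine Finset.sum_congr rfl fun e _ => ?_
    have h1 : s(e.inf, e.sup) = e := Sym2.sortEquiv.symm_apply_apply e
    have he : e.map (ω.2⁻¹ * ψ) = s((ω.2⁻¹ * ψ) e.inf, (ω.2⁻¹ * ψ) e.sup) := by
      conv_lhs => rw [← h1]
      rfl
    simp only [obs, Bmat, Amat, sym_apply, toCoord, gather, coordPerm_inl, coef_inl,
      Sum.elim_inl, h1, he, Equiv.Perm.mul_apply, mul_assoc]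
  · refine Finset.sum_congr rfl fun p _ => ?_
    simp only [obs, Xmat, Ymat, toCoord, gather, coordPerm_inr, coef_inr, Sum.elim_inr,
      Equiv.Perm.mul_apply, mul_assoc]

/-- `ψ` is the unique maximizer of the score. -/
def IsBest (u v : ℝ) (o : Obs n d) (ψ : Equiv.Perm (Fin n)) : Prop :=
  ∀ φ, φ ≠ ψ → obsScore u v φ o < obsScore u v ψ o

lemma IsBest.eq {u v : ℝ} {o : Obs n d} {ψ φ : Equiv.Perm (Fin n)} (hψ : IsBest u v o ψ)
    (hφ : IsBest u v o φ) : ψ = φ :=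
  by_contra fun h => lt_asymm (hψ φ (Ne.symm h)) (hφ ψ h)

open Classical in
/-- The maximizer of the score, when it is unique. -/
def scoreEst (u v : ℝ) (o : Obs n d) : Equiv.Perm (Fin n) :=
  if h : ∃ ψ, IsBest u v o ψ then h.choose else 1

lemma scoreEst_eq {u v : ℝ} {o : Obs n d} {ψ : Equiv.Perm (Fin n)} (h : IsBest u v o ψ) :
    scoreEst u v o = ψ := by
  have h' : ∃ ψ, IsBest u v o ψ := ⟨ψ, h⟩
  rw [scoreEst, dif_pos h']
  exact h'.choose_spec.eq h

lemma measurable_scoreEst (u v : ℝ) : Measurable (scoreEst (n := n) (d := d) u v) := by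
  have hB : ∀ ψ : Equiv.Perm (Fin n), MeasurableSet {o : Obs n d | IsBest u v o ψ} := fun ψ => by
    have : {o : Obs n d | IsBest u v o ψ}
        = ⋂ φ, ⋂ (_ : φ ≠ ψ), {o | obsScore u v φ o < obsScore u v ψ o} := by
      ext o; simp [IsBest]
    rw [this]
    exact MeasurableSet.iInter fun φ => MeasurableSet.iInter fun _ =>
      measurableSet_lt (measurable_obsScore u v φ) (measurable_obsScore u v ψ)
  refine measurable_to_countable' fun ψ => ?_
  have : scoreEst u v ⁻¹' {ψ} = {o : Obs n d | IsBest u v o ψ} ∪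
      {o | ψ = 1 ∧ o ∈ (⋃ φ, {o : Obs n d | IsBest u v o φ})ᶜ} := by
    ext o
    simp only [Set.mem_preimage, Set.mem_singleton_iff, Set.mem_union, Set.mem_ofPred_eq,
      Set.mem_compl_iff, Set.mem_iUnion]
    by_cases h : ∃ φ, IsBest u v o φ
    · obtain ⟨φ, hφ⟩ := h
      rw [scoreEst_eq hφ]
      exact ⟨fun h => Or.inl (h ▸ hφ), fun h => h.elim hφ.eq fun h => absurd ⟨φ, hφ⟩ h.2⟩
    · rw [scoreEst, dif_neg h]
      exact ⟨fun h1 => Or.inr ⟨h1.symm, h⟩, fun h1 => h1.elim (fun h2 => absurd ⟨ψ, h2⟩ h)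
        fun h2 => h2.1.symm⟩
  rw [this]
  exact (hB ψ).union ((MeasurableSet.const _).inter (MeasurableSet.iUnion hB).compl)

lemma scoreEst_obs_eq {u v ρ η : ℝ} {ω : SampU n d}
    (h : ¬∃ φ : Equiv.Perm (Fin n), φ ≠ 1 ∧
      score (coef u v) (coef ρ η) (coef √(1 - ρ ^ 2) √(1 - η ^ 2)) 1 (toCoord ω.1)
        ≤ score (coef u v) (coef ρ η) (coef √(1 - ρ ^ 2) √(1 - η ^ 2)) (coordPerm d φ)
          (toCoord ω.1)) :
    scoreEst u v (obs ρ η ω) = πstar ω := by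
  refine scoreEst_eq fun φ hφ => ?_
  rw [obsScore_obs, obsScore_obs, πstar, inv_mul_cancel, coordPerm_one]
  by_contra hle
  exact h ⟨ω.2⁻¹ * φ, fun h1 => hφ (inv_mul_eq_one.1 h1).symm, not_lt.1 hle⟩

lemma one_sub_le_measure_scoreEst {κ ε u v ρ η : ℝ}
    (h : Regime κ ε (Real.log n) n d u v (coef ρ η) (coef √(1 - ρ ^ 2) √(1 - η ^ 2)))
    (hn : 0 < n) :
    1 - ENNReal.ofReal (2 * exp (-(ε / 2 * Real.log n)) + exp (-n))
      ≤ μU n d {ω | scoreEst u v (obs ρ η ω) = πstar ω} := by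
  set E := {ω : SampU n d | scoreEst u v (obs ρ η ω) = πstar ω}
  set F := {p | ∃ φ : Equiv.Perm (Fin n), φ ≠ 1 ∧
      score (coef u v) (coef ρ η) (coef √(1 - ρ ^ 2) √(1 - η ^ 2)) 1 p
        ≤ score (coef u v) (coef ρ η) (coef √(1 - ρ ^ 2) √(1 - η ^ 2)) (coordPerm d φ) p}
  have hsub : Eᶜ ⊆ (toCoord ⁻¹' F) ×ˢ Set.univ := fun ω hω =>
    ⟨by_contra fun hF => hω (scoreEst_obs_eq hF), Set.mem_univ _⟩
  have hE : μU n d Eᶜ ≤ ENNReal.ofReal (2 * exp (-(ε / 2 * Real.log n)) + exp (-n)) := by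
    refine (measure_mono hsub).trans ?_
    rw [μU, Measure.prod_prod, measure_univ, mul_one]
    refine (Measure.le_map_apply measurePreserving_toCoord.aemeasurable _).trans ?_
    rw [measurePreserving_toCoord.map_eq]
    exact measure_exists_score_le h hn
  rw [tsub_le_iff_right]
  calc (1 : ENNReal) = μU n d Set.univ := measure_univ.symm
    _ ≤ μU n d E + μU n d Eᶜ := measure_univ_le_add_compl E
    _ ≤ _ := add_le_add le_rfl hE

end Estimator

end CGM

namespace CGM

section Truncation

lemma exists_truncated_weight (ρ : ℝ) {c : ℝ} (hc : 0 ≤ c) :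
    ∃ u : ℝ, u ^ 2 = min (ρ ^ 2) c ∧ u ^ 2 ≤ u * ρ ∧ (ρ ^ 2 ≤ 1 → u * ρ ≤ √c) := by
  have key : ∀ ρ : ℝ, 0 ≤ ρ →
      ∃ u : ℝ, u ^ 2 = min (ρ ^ 2) c ∧ u ^ 2 ≤ u * ρ ∧ (ρ ^ 2 ≤ 1 → u * ρ ≤ √c) := by
    intro ρ hρ
    have h0 : 0 ≤ √(min (ρ ^ 2) c) := Real.sqrt_nonneg _
    have h1 : √(min (ρ ^ 2) c) ≤ ρ :=
      (Real.sqrt_le_sqrt (min_le_left _ _)).trans_eq (Real.sqrt_sq hρ)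
    have h2 : √(min (ρ ^ 2) c) ≤ √c := Real.sqrt_le_sqrt (min_le_right _ _)
    refine ⟨√(min (ρ ^ 2) c), Real.sq_sqrt (le_min (sq_nonneg ρ) hc), by nlinarith, fun hρ1 => ?_⟩
    have h3 : ρ ≤ 1 := by nlinarith
    nlinarith
  rcases le_total 0 ρ with h | h
  · exact key ρ h
  · obtain ⟨u, h1, h2, h3⟩ := key (-ρ) (by linarith)
    rw [neg_sq] at h1 h3
    exact ⟨-u, by rwa [neg_sq], by rw [neg_sq]; linarith, fun hρ => by linarith [h3 hρ]⟩

lemma truncated_signal_le {ε κ L ρ η x y : ℝ} (hε : ε ≤ 1) (hκ : κ = ε / 200)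
    (hL : 0 ≤ L) (hε0 : 0 < ε) (hx : 0 < x) (hy : 0 < y)
    (hcx : 4 * (1 + ε / 2) * L / x ≤ κ ^ 2) (hcy : 4 * (1 + ε / 2) * L / y ≤ κ ^ 2)
    (hsig : 4 * (1 + ε) * L ≤ ρ ^ 2 * x / (1 - ρ ^ 2) + η ^ 2 * y / (1 - η ^ 2)) :
    4 * (1 + ε / 2) * L ≤ min (ρ ^ 2) (4 * (1 + ε / 2) * L / x) * x
      + min (η ^ 2) (4 * (1 + ε / 2) * L / y) * y := by
  have hnx : 0 ≤ min (ρ ^ 2) (4 * (1 + ε / 2) * L / x) * x := by positivity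
  have hny : 0 ≤ min (η ^ 2) (4 * (1 + ε / 2) * L / y) * y := by positivity
  rcases le_total (4 * (1 + ε / 2) * L / x) (ρ ^ 2) with h1 | h1
  · rw [min_eq_right h1, div_mul_cancel₀ _ hx.ne']
    linarith
  rcases le_total (4 * (1 + ε / 2) * L / y) (η ^ 2) with h2 | h2
  · rw [min_eq_right h2, div_mul_cancel₀ _ hy.ne']
    linarith
  rw [min_eq_left h1, min_eq_left h2]
  have hκ1 : κ ^ 2 ≤ ε / 8 := by subst hκ; nlinarith
  have hκ0 : 0 < 1 - κ ^ 2 := by linarith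
  have bound : ∀ {a z : ℝ}, 0 < z → a ^ 2 ≤ κ ^ 2 →
      a ^ 2 * z / (1 - a ^ 2) ≤ a ^ 2 * z / (1 - κ ^ 2) := fun hz ha =>
    div_le_div_of_nonneg_left (by positivity) hκ0 (by linarith)
  have h3 : 4 * (1 + ε) * L ≤ (ρ ^ 2 * x + η ^ 2 * y) / (1 - κ ^ 2) := by
    rw [add_div]
    exact hsig.trans (add_le_add (bound hx (h1.trans hcx)) (bound hy (h2.trans hcy)))
  rw [le_div_iff₀ hκ0] at h3
  have h4 : (4 * (1 + ε / 2)) * L ≤ (4 * (1 + ε) * (1 - κ ^ 2)) * L :=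
    mul_le_mul_of_nonneg_right (by nlinarith) hL
  linarith

lemma exists_regime {ε L ρ η : ℝ} {n d : ℕ} (hε0 : 0 < ε) (hε : ε ≤ 1)
    (hn : 0 < n) (hd : 0 < d) (hρ : ρ ^ 2 ≤ 1) (hη : η ^ 2 ≤ 1) (h5 : 10 / ε ≤ L)
    (h4 : 4 / (ε / 200) ^ 3 ≤ L) (hcn : 4 * (1 + ε / 2) * L / n ≤ (ε / 200) ^ 2)
    (hcd : 4 * (1 + ε / 2) * L / d ≤ (ε / 200) ^ 2)
    (hsig : 4 * (1 + ε) * L ≤ ρ ^ 2 * n / (1 - ρ ^ 2) + η ^ 2 * d / (1 - η ^ 2)) :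
    ∃ u v : ℝ, Regime (ε / 200) (ε / 2) L n d u v (coef ρ η)
      (coef √(1 - ρ ^ 2) √(1 - η ^ 2)) := by
  have hL : 0 < L := lt_of_lt_of_le (by positivity) h5
  have hn' : (0 : ℝ) < n := by exact_mod_cast hn
  have hd' : (0 : ℝ) < d := by exact_mod_cast hd
  obtain ⟨u, hu1, hu2, hu3⟩ := exists_truncated_weight ρ
    (show 0 ≤ 4 * (1 + ε / 2) * L / n by positivity)
  obtain ⟨v, hv1, hv2, hv3⟩ := exists_truncated_weight η
    (show 0 ≤ 4 * (1 + ε / 2) * L / d by positivity)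
  have hκ : 0 ≤ ε / 200 := by positivity
  refine ⟨u, v, by positivity, by linarith, by ring, ⟨?_, ?_, ?_, ?_⟩,
    coef_coordPerm _ _, coef_coordPerm _ _, ?_, ?_, ?_⟩
  · rintro (e | p)
    · exact hu2
    · exact hv2
  · rintro (e | p)
    · exact (hu3 hρ).trans ((Real.sqrt_le_sqrt hcn).trans_eq (Real.sqrt_sq hκ))
    · exact (hv3 hη).trans ((Real.sqrt_le_sqrt hcd).trans_eq (Real.sqrt_sq hκ))
  · rintro (e | p)
    · exact hu1.trans_le ((min_le_right _ _).trans hcn)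
    · exact hv1.trans_le ((min_le_right _ _).trans hcd)
  · rintro (e | p)
    · simp only [coef_inl]
      rw [Real.sq_sqrt (by linarith)]
      linarith [sq_nonneg ρ]
    · simp only [coef_inr]
      rw [Real.sq_sqrt (by linarith)]
      linarith [sq_nonneg η]
  · rw [hu1, hv1]
    exact truncated_signal_le hε rfl hL.le hε0 hn' hd' hcn hcd hsig
  · rw [div_le_iff₀ hε0] at h5
    linarith
  · rwa [div_le_iff₀' (by positivity)] at h4

end Truncation

end CGM

/-- **Exact recovery, achievability.**  In the Gaussian contextual graph matching model
with parameters `(n, d n, ρ n, η n)`, if `d = ω(log n)` and for some `ε > 0` and all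
sufficiently large `n` one has `ρ²n/(1−ρ²) + η²d/(1−η²) ≥ 4(1+ε) log n`, then there exists
a (measurable) estimator `π̂(A,B,X,Y)` such that `P(π̂ = π*) = 1 − o(1)`. -/
theorem exact_recovery_achievability
    (d : ℕ → ℕ) (ρ η : ℕ → ℝ)
    (hρ : ∀ n, ρ n ∈ Set.Icc (-1 : ℝ) 1) (hη : ∀ n, η n ∈ Set.Icc (-1 : ℝ) 1)
    (hd : Tendsto (fun n : ℕ => (d n : ℝ) / Real.log n) atTop atTop)
    (hsig : ∃ ε > (0 : ℝ), ∀ᶠ n : ℕ in atTop,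
      4 * (1 + ε) * Real.log n ≤
        (ρ n) ^ 2 * n / (1 - (ρ n) ^ 2) + (η n) ^ 2 * (d n) / (1 - (η n) ^ 2)) :
    ∃ est : (n : ℕ) → CGM.Obs n (d n) → Equiv.Perm (Fin n),
      (∀ n, Measurable (est n)) ∧
      Tendsto
        (fun n => CGM.μU n (d n) {ω | est n (CGM.obs (ρ n) (η n) ω) = CGM.πstar ω})
        atTop (𝓝 1) := by
  obtain ⟨ε₀, hε₀, hsig⟩ := hsig
  set ε := min ε₀ 1
  have hε0 : 0 < ε := lt_min hε₀ one_pos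
  have hlog : Tendsto (fun n : ℕ => Real.log n) atTop atTop :=
    Real.tendsto_log_atTop.comp tendsto_natCast_atTop_atTop
  have hlogn : Tendsto (fun n : ℕ => 4 * (1 + ε / 2) * Real.log n / n) atTop (𝓝 0) := by
    have h := (Real.isLittleO_log_id_atTop.tendsto_div_nhds_zero.comp
      tendsto_natCast_atTop_atTop).const_mul (4 * (1 + ε / 2))
    rw [mul_zero] at h
    exact h.congr fun n => (mul_div_assoc _ _ _).symm
  have hlogd : Tendsto (fun n : ℕ => 4 * (1 + ε / 2) * Real.log n / d n) atTop (𝓝 0) := by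
    have h := hd.inv_tendsto_atTop.const_mul (4 * (1 + ε / 2))
    rw [mul_zero] at h
    exact h.congr fun n => by rw [Pi.inv_apply, inv_div, mul_div_assoc]
  have hκ : 0 < (ε / 200) ^ 2 := by positivity
  have hev : ∀ᶠ n : ℕ in atTop, 0 < n ∧ ∃ u v : ℝ, CGM.Regime (ε / 200) (ε / 2) (Real.log n) n (d n)
      u v (CGM.coef (ρ n) (η n)) (CGM.coef √(1 - ρ n ^ 2) √(1 - η n ^ 2)) := by
    filter_upwards [hsig, eventually_gt_atTop 0, hd.eventually_gt_atTop 0,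
      hlog.eventually_ge_atTop (10 / ε), hlog.eventually_ge_atTop (4 / (ε / 200) ^ 3),
      hlogn.eventually_le_const hκ, hlogd.eventually_le_const hκ]
      with n h1 hn h2 h3 h4 h5 h6
    have hL : 0 < Real.log n := lt_of_lt_of_le (by positivity) h3
    have hdn : 0 < d n := by
      rcases Nat.eq_zero_or_pos (d n) with h0 | h0
      · simp [h0] at h2
      · exact h0
    refine ⟨hn, CGM.exists_regime hε0 (min_le_right _ _) hn hdn
      (by nlinarith [(hρ n).1, (hρ n).2]) (by nlinarith [(hη n).1, (hη n).2]) h3 h4 h5 h6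
      (le_trans ?_ h1)⟩
    have : ε ≤ ε₀ := min_le_left _ _
    gcongr
  have hex : ∀ n : ℕ, ∃ u v : ℝ, (∃ u v : ℝ, CGM.Regime (ε / 200) (ε / 2) (Real.log n) n (d n)
      u v (CGM.coef (ρ n) (η n)) (CGM.coef √(1 - ρ n ^ 2) √(1 - η n ^ 2))) →
      CGM.Regime (ε / 200) (ε / 2) (Real.log n) n (d n)
      u v (CGM.coef (ρ n) (η n)) (CGM.coef √(1 - ρ n ^ 2) √(1 - η n ^ 2)) := fun n => by
    by_cases h : ∃ u v : ℝ, CGM.Regime (ε / 200) (ε / 2) (Real.log n) n (d n)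
      u v (CGM.coef (ρ n) (η n)) (CGM.coef √(1 - ρ n ^ 2) √(1 - η n ^ 2))
    · obtain ⟨u, v, h⟩ := h
      exact ⟨u, v, fun _ => h⟩
    · exact ⟨0, 0, fun h' => absurd h' h⟩
  choose u v huv using hex
  refine ⟨fun n => CGM.scoreEst (u n) (v n), fun n => CGM.measurable_scoreEst _ _, ?_⟩
  have hb : Tendsto (fun n : ℕ => (1 : ENNReal) - ENNReal.ofReal
      (2 * exp (-(ε / 2 / 2 * Real.log n)) + exp (-n))) atTop (𝓝 1) := by
    have h1 : Tendsto (fun n : ℕ => 2 * exp (-(ε / 2 / 2 * Real.log n)) + exp (-(n : ℝ)))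
        atTop (𝓝 0) := by
      have h2 := (Real.tendsto_exp_neg_atTop_nhds_zero.comp
        (hlog.const_mul_atTop (show 0 < ε / 2 / 2 by positivity))).const_mul 2
      have h3 := Real.tendsto_exp_neg_atTop_nhds_zero.comp (tendsto_natCast_atTop_atTop (R := ℝ))
      simpa using h2.add h3
    have h4 := ENNReal.Tendsto.sub (tendsto_const_nhds (x := (1 : ENNReal)))
      (ENNReal.tendsto_ofReal h1) (Or.inl ENNReal.one_ne_top)
    simpa using h4
  refine tendsto_of_tendsto_of_tendsto_of_le_of_le' hb tendsto_const_nhds ?_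
    (Eventually.of_forall fun n => prob_le_one)
  filter_upwards [hev] with n hn
  exact CGM.one_sub_le_measure_scoreEst (huv n hn.2) hn.1
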